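/- Let n, n̄ ≥ 0, let A ∈ GL_n(ℚ), Ā ∈ GL_n̄(ℚ), and let L ≤ ℤ^n ∩ A⁻¹(ℤ^n) and L̄ ≤ ℤ^n̄ ∩ Ā⁻¹(ℤ^n̄) be finite-index subgroups. Then G(A,L) ≅ G(Ā,L̄) if and only if n = n̄ and at least one of the following holds: (i) there exists B ∈ GL_n(ℤ) such that either Ā = BAB⁻¹ and L̄ = BL, or Ā = BA⁻¹B⁻¹ and L̄ = B(AL); (ii) either L = ℤ^n or AL = ℤ^n, either L̄ = ℤ^n or ĀL̄ = ℤ^n, and there exists B ∈ GL_n(ℚ) with Ā = BA^εB⁻¹ for some ε ∈ {±1} and ⋃_{j∈ℤ} A^j(ℤ^n) = ⋃_{j∈ℤ} A^jB⁻¹(ℤ^n); (iii) L = AL = L̄ = ĀL̄ = ℤ^n, and there exist a matrix C ∈ GL_{n-1}(ℤ) of finite order m, a vector u ∈ ℤ^{n-1}, and q ∈ ℤ with gcd(q,m) = 1 such that A and Ā are conjugate in GL_n(ℤ) to the block matrices [[1, 0ᵀ],[u, C]] and [[1, 0ᵀ],[u, C^q]], respectively. -/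

import Mathlib

open Matrix

noncomputable section

/-- The coercion `ℤ^n → ℚ^n` as an additive homomorphism. -/
def ZtoQ (n : ℕ) : (Fin n → ℤ) →+ (Fin n → ℚ) :=
  AddMonoidHom.mk' (fun v i => (v i : ℚ)) (by intro a b; funext i; simp)

/-- The image `A·L ⊆ ℚ^n` of a subgroup `L ≤ ℤ^n` under the matrix `A`. -/
def QImage {n : ℕ} (A : Matrix (Fin n) (Fin n) ℚ) (L : AddSubgroup (Fin n → ℤ)) :
    AddSubgroup (Fin n → ℚ) :=
  (L.map (ZtoQ n)).map A.mulVecLin.toAddMonoidHom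

/-- The subgroup `AL` of `ℤ^n`, i.e. the set of integer vectors lying in `A·L`. -/
def ALsub {n : ℕ} (A : Matrix (Fin n) (Fin n) ℚ) (L : AddSubgroup (Fin n → ℤ)) :
    AddSubgroup (Fin n → ℤ) :=
  (QImage A L).comap (ZtoQ n)

/-- `x^v = x_1^{v_1} ⋯ x_n^{v_n}` in the free group on `x_1,…,x_n,t`. -/
def xWord (n : ℕ) (v : Fin n → ℤ) : FreeGroup (Fin n ⊕ Unit) :=
  (List.ofFn fun i => (FreeGroup.of (Sum.inl i) : FreeGroup (Fin n ⊕ Unit)) ^ (v i)).prod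

/-- The relations of the Leary–Minasyan group `G(A,L)`. -/
def LMrels (n : ℕ) (A : Matrix (Fin n) (Fin n) ℚ) (L : AddSubgroup (Fin n → ℤ)) :
    Set (FreeGroup (Fin n ⊕ Unit)) :=
  {r | (∃ i j : Fin n,
          r = FreeGroup.of (Sum.inl i) * FreeGroup.of (Sum.inl j) *
              (FreeGroup.of (Sum.inl i))⁻¹ * (FreeGroup.of (Sum.inl j))⁻¹) ∨
       (∃ v ∈ L, ∃ w : Fin n → ℤ, ZtoQ n w = A.mulVec (ZtoQ n v) ∧
          r = FreeGroup.of (Sum.inr ()) * xWord n v * (FreeGroup.of (Sum.inr ()))⁻¹ *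
              (xWord n w)⁻¹)}

/-- The Leary–Minasyan group `G(A,L)`. -/
abbrev LM (n : ℕ) (A : Matrix (Fin n) (Fin n) ℚ) (L : AddSubgroup (Fin n → ℤ)) :=
  PresentedGroup (LMrels n A L)

/-- The generator `x_i` of `G(A,L)`. -/
def Xg (n : ℕ) (A : Matrix (Fin n) (Fin n) ℚ) (L : AddSubgroup (Fin n → ℤ)) (i : Fin n) :
    LM n A L :=
  PresentedGroup.of (Sum.inl i)

/-- The stable letter `t` of `G(A,L)`. -/
def Tg (n : ℕ) (A : Matrix (Fin n) (Fin n) ℚ) (L : AddSubgroup (Fin n → ℤ)) : LM n A L :=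
  PresentedGroup.of (Sum.inr ())

/-- The element `x^v` of `G(A,L)`. -/
def Xv (n : ℕ) (A : Matrix (Fin n) (Fin n) ℚ) (L : AddSubgroup (Fin n → ℤ)) (v : Fin n → ℤ) :
    LM n A L :=
  (List.ofFn fun i => (Xg n A L i) ^ (v i)).prod

/-- The base subgroup `H = ⟨x_1,…,x_n⟩` of `G(A,L)`. -/
def Hsub (n : ℕ) (A : Matrix (Fin n) (Fin n) ℚ) (L : AddSubgroup (Fin n → ℤ)) :
    Subgroup (LM n A L) :=
  Subgroup.closure (Set.range (Xg n A L))

/-- The set `⋃_{j∈ℤ} A^j(ℤ^n) ⊆ ℚ^n`. -/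
def unionSet {n : ℕ} (A : Matrix (Fin n) (Fin n) ℚ) : Set (Fin n → ℚ) :=
  ⋃ j : ℤ, (A ^ j).mulVec '' Set.range (ZtoQ n)

/-- Cast an integer matrix to a rational matrix. -/
def QMat {k : ℕ} (M : Matrix (Fin k) (Fin k) ℤ) : Matrix (Fin k) (Fin k) ℚ :=
  M.map (Int.cast)

/-- The block matrix `[[1, 0ᵀ],[u, C]]`. -/
def blockOne {k : ℕ} (u : Fin k → ℤ) (C : Matrix (Fin k) (Fin k) ℤ) :
    Matrix (Fin (k+1)) (Fin (k+1)) ℤ :=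
  Matrix.of fun i j =>
    Fin.cases (Fin.cases 1 (fun _ => 0) j) (fun i' => Fin.cases (u i') (fun j' => C i' j') j) i

/-- Transport a subgroup of `ℤ^a` along an equality `a = b` of dimensions. -/
def reindexSub {a b : ℕ} (h : a = b) (L : AddSubgroup (Fin a → ℤ)) :
    AddSubgroup (Fin b → ℤ) :=
  L.map (AddMonoidHom.mk' (fun v => v ∘ (finCongr h).symm) (fun _ _ => rfl))

namespace HNNExtension

variable {G : Type*} [Group G] {A B : Subgroup G} {φ : A ≃* B}

/-- The product `t^{u₁} g₁ ⋯ t^{uₖ} gₖ` of a list of letters. -/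
def listProd (φ : A ≃* B) (l : List (ℤˣ × G)) : HNNExtension G A B φ :=
  (l.map fun x => t ^ (x.1 : ℤ) * of x.2).prod

variable (A B) in
/-- A list of letters without pinches. -/
def IsReduced (l : List (ℤˣ × G)) : Prop :=
  l.IsChain fun a b => a.2 ∈ toSubgroup A B a.1 → a.1 = b.1

/-- The elements whose reduced form begins with `t ^ u`: a half-tree of the Bass–Serre tree. -/
def halfTree (φ : A ≃* B) (u : ℤˣ) : Set (HNNExtension G A B φ) :=
  {x | ∃ g l, IsReduced A B ((u, g) :: l) ∧ x = listProd φ ((u, g) :: l)}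

@[simp] lemma listProd_nil : listProd φ [] = 1 := rfl

@[simp] lemma listProd_cons (a : ℤˣ × G) (l : List (ℤˣ × G)) :
    listProd φ (a :: l) = t ^ (a.1 : ℤ) * of a.2 * listProd φ l := by
  simp [listProd]

@[simp] lemma listProd_append (l l' : List (ℤˣ × G)) :
    listProd φ (l ++ l') = listProd φ l * listProd φ l' := by
  simp [listProd]

lemma exists_reduced (x : HNNExtension G A B φ) :
    ∃ g l, IsReduced A B l ∧ x = of g * listProd φ l := by
  obtain ⟨d⟩ := NormalWord.TransversalPair.nonempty G A B
  refine ⟨(x • (NormalWord.empty : NormalWord d)).head, _,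
    (x • (NormalWord.empty : NormalWord d)).chain, ?_⟩
  have := NormalWord.prod_smul (φ := φ) x (NormalWord.empty : NormalWord d)
  simp only [NormalWord.prod_empty, mul_one] at this
  conv_lhs => rw [← this]
  rfl

lemma of_notMem_halfTree (g : G) (u : ℤˣ) : (of g : HNNExtension G A B φ) ∉ halfTree φ u := by
  rintro ⟨g', l, hl, h⟩
  have := ReducedWord.toList_eq_nil_of_mem_of_range φ ⟨1, (u, g') :: l, hl⟩
    ⟨g, by rw [h]; simp [NormalWord.ReducedWord.prod, listProd]⟩
  simp at this

lemma halfTree_inter {u u' : ℤˣ} {g : G} {x : HNNExtension G A B φ} (hx : x ∈ halfTree φ u)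
    (hgx : of g * x ∈ halfTree φ u') : u = u' ∧ g ∈ toSubgroup A B (-u) := by
  obtain ⟨a, l, hl, rfl⟩ := hx
  obtain ⟨b, l', hl', h⟩ := hgx
  have := ReducedWord.map_fst_eq_and_of_prod_eq φ (w₁ := ⟨1, (u', b) :: l', hl'⟩)
    (w₂ := ⟨g, (u, a) :: l, hl⟩)
    (by simpa [NormalWord.ReducedWord.prod, listProd] using h.symm)
  simp only [List.map_cons, List.cons.injEq, List.head?_cons, Option.map_some, Option.mem_def,
    Option.some.injEq, forall_eq', inv_one, one_mul] at this
  obtain ⟨⟨rfl, -⟩, h2⟩ := this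
  exact ⟨rfl, h2⟩

lemma exists_zpow_mul_of {u : ℤˣ} {g : G} (hg : g ∈ toSubgroup A B u) :
    ∃ g' ∈ toSubgroup A B (-u),
      (t ^ (u : ℤ) * of g : HNNExtension G A B φ) = of g' * t ^ (u : ℤ) := by
  rcases Int.units_eq_one_or u with rfl | rfl
  · exact ⟨φ ⟨g, hg⟩, (φ ⟨g, hg⟩).2, by
      rw [Units.val_one, zpow_one]; exact t_mul_of (φ := φ) ⟨g, hg⟩⟩
  · exact ⟨φ.symm ⟨g, hg⟩, (φ.symm ⟨g, hg⟩).2, by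
      rw [Units.val_neg, Units.val_one, _root_.zpow_neg, zpow_one]
      exact inv_t_mul_of (φ := φ) ⟨g, hg⟩⟩

lemma exists_of_mul_zpow {u : ℤˣ} {g : G} (hg : g ∈ toSubgroup A B (-u)) :
    ∃ g' ∈ toSubgroup A B u,
      (of g * t ^ (u : ℤ) : HNNExtension G A B φ) = t ^ (u : ℤ) * of g' := by
  obtain ⟨g', hg', h⟩ := exists_zpow_mul_of (φ := φ) hg
  refine ⟨g', by simpa using hg', ?_⟩
  rw [Units.val_neg, _root_.zpow_neg, inv_mul_eq_iff_eq_mul, ← mul_assoc, eq_mul_inv_iff_mul_eq] at h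
  exact h

lemma zpow_mul_mem_halfTree {u : ℤˣ} {x : HNNExtension G A B φ} (hx : x ∉ halfTree φ (-u)) :
    t ^ (u : ℤ) * x ∈ halfTree φ u := by
  obtain ⟨g, l, hl, rfl⟩ := exists_reduced x
  refine ⟨g, l, ?_, by simp [mul_assoc]⟩
  cases l with
  | nil => exact List.isChain_singleton _
  | cons a l =>
    refine List.isChain_cons_cons.2 ⟨fun hg => ?_, hl⟩
    by_contra hne
    have ha : a.1 = -u := Int.units_ne_iff_eq_neg.1 (Ne.symm hne)
    obtain ⟨v, b⟩ := a
    simp only at ha hg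
    subst ha
    obtain ⟨g', hg'm, hg'⟩ := exists_of_mul_zpow (φ := φ) (u := -u) (g := g) (by simpa using hg)
    refine hx ⟨g' * b, l, ?_, ?_⟩
    · cases l with
      | nil => exact List.isChain_singleton _
      | cons c l =>
        rw [IsReduced, List.isChain_cons_cons] at hl ⊢
        exact ⟨fun h => hl.1 ((Subgroup.mul_mem_cancel_left _ hg'm).1 h), hl.2⟩
    · simp only [listProd_cons, map_mul, ← mul_assoc]
      rw [← hg']

lemma listProd_mul_mem_halfTree (l : List (ℤˣ × G)) (a : ℤˣ × G) (hl : IsReduced A B (a :: l))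
    {x : HNNExtension G A B φ}
    (hx : of ((a :: l).getLast (List.cons_ne_nil _ _)).2 * x ∉
      halfTree φ (-((a :: l).getLast (List.cons_ne_nil _ _)).1)) :
    listProd φ (a :: l) * x ∈ halfTree φ a.1 := by
  induction l generalizing a with
  | nil =>
    have := zpow_mul_mem_halfTree hx
    simpa [mul_assoc] using this
  | cons b l ih =>
    rw [IsReduced, List.isChain_cons_cons] at hl
    have h1 := ih b hl.2 (by simpa using hx)
    rw [listProd_cons, mul_assoc, mul_assoc]
    refine zpow_mul_mem_halfTree fun h2 => ?_
    obtain ⟨h3, h4⟩ := halfTree_inter h1 h2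
    rw [h3, neg_neg] at h4
    have h5 := hl.1 h4
    rw [← h5] at h3
    exact units_ne_neg_self _ h3

lemma inv_listProd_mul_mem (l : List (ℤˣ × G)) (a : ℤˣ × G) (hl : IsReduced A B (a :: l))
    {x : HNNExtension G A B φ} (hx : x ∉ halfTree φ a.1) :
    of ((a :: l).getLast (List.cons_ne_nil _ _)).2 * ((listProd φ (a :: l))⁻¹ * x) ∈
      halfTree φ (-((a :: l).getLast (List.cons_ne_nil _ _)).1) := by
  by_contra h
  have := listProd_mul_mem_halfTree l a hl h
  rw [mul_inv_cancel_left] at this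
  exact hx this

lemma exists_listProd_mul_of (l : List (ℤˣ × G)) (hl : IsReduced A B l) (hl0 : l ≠ []) (g : G) :
    ∃ l', IsReduced A B l' ∧ l'.length = l.length ∧ listProd φ l' = listProd φ l * of g := by
  obtain ⟨l, ⟨a, b⟩, rfl⟩ := l.eq_nil_or_concat.resolve_left hl0
  refine ⟨l ++ [(a, b * g)], ?_, by simp, by simp [mul_assoc]⟩
  simp only [List.concat_eq_append] at hl
  rw [IsReduced, List.isChain_append] at hl ⊢
  exact ⟨hl.1, List.isChain_singleton _, fun x hx y hy => by
    simp at hy; subst hy; exact hl.2.2 x hx (a, b) (by simp)⟩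

/-- Cyclically reduced lists. -/
def IsCyclicallyReduced (A B : Subgroup G) (a : ℤˣ × G) (l : List (ℤˣ × G)) : Prop :=
  IsReduced A B (a :: l) ∧ (((a :: l).getLast (List.cons_ne_nil _ _)).2 ∈
    toSubgroup A B ((a :: l).getLast (List.cons_ne_nil _ _)).1 →
      ((a :: l).getLast (List.cons_ne_nil _ _)).1 = a.1)

lemma exists_conj_cyclicallyReduced (l : List (ℤˣ × G)) (hl : IsReduced A B l) :
    (∃ x : HNNExtension G A B φ, x * listProd φ l * x⁻¹ ∈ (of : G →* HNNExtension G A B φ).range) ∨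
    ∃ (x : HNNExtension G A B φ) (a : _) (l' : _), IsCyclicallyReduced A B a l' ∧
      x * listProd φ l * x⁻¹ = listProd φ (a :: l') := by
  induction hn : l.length using Nat.strong_induction_on generalizing l with
  | _ n ih =>
  cases l with
  | nil => exact .inl ⟨1, by simp⟩
  | cons a l =>
    by_cases hc : IsCyclicallyReduced A B a l
    · exact .inr ⟨1, a, l, hc, by simp⟩
    · simp only [IsCyclicallyReduced, hl, true_and, Classical.not_imp] at hc
      rcases l.eq_nil_or_concat with rfl | ⟨l, ⟨v, k⟩, rfl⟩
      · simp at hc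
      · simp only [List.concat_eq_append] at *
        obtain ⟨u, g⟩ := a
        simp only [← List.cons_append, List.getLast_append_singleton] at hc
        obtain ⟨hk, hv⟩ := hc
        obtain rfl : v = -u := Int.units_ne_iff_eq_neg.1 hv
        obtain ⟨k', -, hk'⟩ := exists_zpow_mul_of (φ := φ) hk
        have hred : IsReduced A B l := by
          rw [IsReduced, List.isChain_cons, List.isChain_append] at hl
          exact hl.2.1
        have key : ((t : HNNExtension G A B φ) ^ (u : ℤ) * of g)⁻¹ *
            listProd φ ((u, g) :: (l ++ [(-u, k)])) *
            ((t : HNNExtension G A B φ) ^ (u : ℤ) * of g)⁻¹⁻¹ = listProd φ l * of (k' * g) := by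
          simp only [listProd_cons, listProd_append, listProd_nil, hk', map_mul]
          simp [mul_assoc]
        by_cases hl0 : l = []
        · subst hl0
          left
          exact ⟨_, k' * g, by rw [key]; simp⟩
        · obtain ⟨l', h1, h2, h3⟩ := exists_listProd_mul_of (φ := φ) l hred hl0 (k' * g)
          rw [← h3] at key
          rcases ih _ (by rw [← hn, h2]; simp) l' h1 rfl with ⟨x, hx⟩ | ⟨x, b, m, hm, hx⟩
          · left
            rw [← key] at hx
            exact ⟨x * ((t : HNNExtension G A B φ) ^ (u : ℤ) * of g)⁻¹, by
              rw [_root_.mul_inv_rev x]; simpa only [mul_assoc] using hx⟩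
          · right
            rw [← key] at hx
            exact ⟨x * ((t : HNNExtension G A B φ) ^ (u : ℤ) * of g)⁻¹, b, m, hm, by
              rw [_root_.mul_inv_rev x]; simpa only [mul_assoc] using hx⟩

lemma exists_conj_mem_range_or (p : HNNExtension G A B φ) :
    (∃ x : HNNExtension G A B φ, x * p * x⁻¹ ∈ (of : G →* HNNExtension G A B φ).range) ∨
    ∃ (x : HNNExtension G A B φ) (a : _) (l' : _), IsCyclicallyReduced A B a l' ∧
      x * p * x⁻¹ = listProd φ (a :: l') := by
  obtain ⟨g, l, hl, rfl⟩ := exists_reduced p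
  by_cases hl0 : l = []
  · subst hl0
    exact .inl ⟨1, g, by simp⟩
  obtain ⟨l', h1, -, h3⟩ := exists_listProd_mul_of (φ := φ) l hl hl0 g
  rcases exists_conj_cyclicallyReduced (φ := φ) l' h1 with ⟨x, hx⟩ | ⟨x, b, m, hm, hx⟩
  · exact .inl ⟨x * (of g)⁻¹, by simpa [h3, mul_assoc] using hx⟩
  · exact .inr ⟨x * (of g)⁻¹, b, m, hm, by simpa [h3, mul_assoc] using hx⟩

lemma exists_disjoint_halfTree (hA : A ≠ ⊤) (hB : B ≠ ⊤) (u u' : ℤˣ) (k : G)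
    (hk : k ∈ toSubgroup A B u' → u' = u) :
    ∃ (e : ℤˣ) (c : G), ∀ z : HNNExtension G A B φ,
      (z ∈ halfTree φ u ∨ of k * z ∈ halfTree φ (-u')) → of c⁻¹ * z ∉ halfTree φ e := by
  have htop : ∀ v, toSubgroup A B v ≠ ⊤ := by
    intro v
    rcases Int.units_eq_one_or v with rfl | rfl
    · exact hA
    · exact hB
  by_cases h : u' = u
  · subst h
    obtain ⟨c, -, hc⟩ := SetLike.exists_of_lt (htop (-u')).lt_top
    refine ⟨u', c, fun z hz hz' => ?_⟩
    rcases hz with hz | hz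
    · exact hc (by simpa using (halfTree_inter hz hz').2)
    · have : of (c⁻¹ * k⁻¹) * (of k * z) ∈ halfTree φ u' := by simpa [mul_assoc] using hz'
      exact units_ne_neg_self _ (halfTree_inter hz this).1.symm
  · have hu : u' = -u := Int.units_ne_iff_eq_neg.1 h
    refine ⟨-u, 1, fun z hz hz' => ?_⟩
    rcases hz with hz | hz
    · exact units_ne_neg_self _ (halfTree_inter hz hz').1
    · have : of (1⁻¹ * k⁻¹) * (of k * z) ∈ halfTree φ (-u) := by simpa [mul_assoc] using hz'
      have := (halfTree_inter hz this).1
      rw [hu, neg_neg] at this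
      exact units_ne_neg_self _ this

/-- An element virtually commuting with all its conjugates is conjugate into the base group. -/
lemma elliptic_of_commute (hA : A ≠ ⊤) (hB : B ≠ ⊤) (p : HNNExtension G A B φ)
    (hp : ∀ x : HNNExtension G A B φ, ∃ k : ℕ, 0 < k ∧ Commute (x * p ^ k * x⁻¹) p) :
    ∃ x : HNNExtension G A B φ, x * p * x⁻¹ ∈ (of : G →* HNNExtension G A B φ).range := by
  refine (exists_conj_mem_range_or p).resolve_right ?_
  rintro ⟨w, a, l, ⟨hl, hcyc⟩, hw⟩
  obtain ⟨q, hq⟩ : ∃ q, q = listProd φ (a :: l) := ⟨_, rfl⟩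
  have hp' : ∀ x : HNNExtension G A B φ, ∃ k : ℕ, 0 < k ∧ Commute (x * q ^ k * x⁻¹) q := by
    intro x
    obtain ⟨k, hk, h⟩ := hp (w⁻¹ * x * w)
    refine ⟨k, hk, ?_⟩
    rw [hq, ← hw, conj_pow]
    have := (Commute.conj_iff w).2 h
    convert this using 1
    group
  set b := (a :: l).getLast (List.cons_ne_nil _ _) with hb
  have hdisj : ∀ z, z ∈ halfTree φ a.1 → of b.2 * z ∉ halfTree φ (-b.1) := by
    intro z hz hz'
    obtain ⟨h1, h2⟩ := halfTree_inter hz hz'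
    rw [h1, neg_neg] at h2
    rw [← hcyc h2] at h1
    exact units_ne_neg_self _ h1
  have hmap : ∀ z, of b.2 * z ∉ halfTree φ (-b.1) → q * z ∈ halfTree φ a.1 := by
    intro z hz
    rw [hq]
    exact listProd_mul_mem_halfTree l a hl hz
  have hpow : ∀ (n : ℕ) z, of b.2 * z ∉ halfTree φ (-b.1) → q ^ (n + 1) * z ∈ halfTree φ a.1 := by
    intro n z hz
    induction n with
    | zero => simpa using hmap z hz
    | succ n ih =>
      rw [pow_succ', mul_assoc]
      exact hmap _ (hdisj _ ih)
  obtain ⟨e, c, hec⟩ := exists_disjoint_halfTree (φ := φ) hA hB a.1 b.1 b.2 hcyc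
  obtain ⟨m, hm⟩ : ∃ m, m ∉ toSubgroup A B e := by
    rcases Int.units_eq_one_or e with rfl | rfl
    · simpa using SetLike.exists_of_lt hA.lt_top
    · simpa using SetLike.exists_of_lt hB.lt_top
  obtain ⟨y, hy⟩ : ∃ y : HNNExtension G A B φ,
    y = of c * t ^ (e : ℤ) * of m * t ^ (-(e : ℤ)) * of c⁻¹ := ⟨_, rfl⟩
  have hyW : ∀ z, (z ∈ halfTree φ a.1 ∨ of b.2 * z ∈ halfTree φ (-b.1)) →
      of c⁻¹ * (y * z) ∈ halfTree φ e := by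
    intro z hz
    have h1 := hec z hz
    have h2 := zpow_mul_mem_halfTree (φ := φ) (u := -e) (by rwa [neg_neg])
    have h3 : of m * (t ^ ((-e : ℤˣ) : ℤ) * (of c⁻¹ * z)) ∉ halfTree φ (-e) := fun h =>
      hm (by simpa using (halfTree_inter h2 h).2)
    have h4 := zpow_mul_mem_halfTree (φ := φ) h3
    rw [hy]
    simpa [mul_assoc] using h4
  have hy' : ∀ z, (z ∈ halfTree φ a.1 ∨ of b.2 * z ∈ halfTree φ (-b.1)) →
      y * z ∉ halfTree φ a.1 ∧ of b.2 * (y * z) ∉ halfTree φ (-b.1) := by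
    intro z hz
    have h := hyW z hz
    exact ⟨fun h' => hec _ (.inl h') h, fun h' => hec _ (.inr h') h⟩
  obtain ⟨k, hk, hcomm⟩ := hp' y
  obtain ⟨k, rfl⟩ : ∃ j, k = j + 1 := ⟨k - 1, by omega⟩
  have h1 : of b.2 * y⁻¹ ∉ halfTree φ (-b.1) := fun h => by
    have := hyW _ (.inr h)
    rw [mul_inv_cancel, mul_one] at this
    exact of_notMem_halfTree _ _ this
  have h2 : of b.2 * (y⁻¹ * q) ∉ halfTree φ (-b.1) := fun h => by
    have := (hy' _ (.inr h)).1
    rw [mul_inv_cancel_left] at this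
    refine this ?_
    simpa using hmap 1 (by simpa using of_notMem_halfTree (φ := φ) b.2 (-b.1))
  have h3 := (hy' _ (.inl (hpow k _ h1))).2
  have h4 := hmap _ h3
  have h5 := (hy' _ (.inl (hpow k _ h2))).1
  apply h5
  convert h4 using 1
  simpa [mul_assoc] using hcomm.eq

lemma joint_conj_aux (n : ℕ) : ∀ (l : List (ℤˣ × G)) (_ : IsReduced A B l) (_ : l.length = n)
    (h g₀ : G) (Q : Set (HNNExtension G A B φ)),
    Q ⊆ (of : G →* HNNExtension G A B φ).range →
    (∀ q ∈ Q, Commute q (of g₀ * listProd φ l * of h * (listProd φ l)⁻¹ * (of g₀)⁻¹)) →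
    ∃ x : HNNExtension G A B φ, (∀ q ∈ Q, x * q * x⁻¹ ∈ (of : G →* HNNExtension G A B φ).range) ∧
      x * (of g₀ * listProd φ l * of h * (listProd φ l)⁻¹ * (of g₀)⁻¹) * x⁻¹ ∈
        (of : G →* HNNExtension G A B φ).range := by
  induction n with
  | zero =>
    intro l hl hn h g₀ Q hQ hcomm
    obtain rfl := List.length_eq_zero_iff.1 hn
    exact ⟨1, fun q hq => by simpa using hQ hq, g₀ * h * g₀⁻¹, by simp⟩
  | succ n ih =>
    intro l hl hn h g₀ Q hQ hcomm
    have hl0 : l ≠ [] := by rintro rfl; simp at hn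
    obtain ⟨b, hb⟩ : ∃ b, b = l.getLast hl0 := ⟨_, rfl⟩
    by_cases hbh : b.2 * h * b.2⁻¹ ∈ toSubgroup A B b.1
    · obtain ⟨h', -, hh'⟩ := exists_zpow_mul_of (φ := φ) hbh
      have hsplit := List.dropLast_append_getLast hl0
      rw [← hb] at hsplit
      have hred : IsReduced A B l.dropLast := by
        rw [← hsplit, IsReduced, List.isChain_append] at hl
        exact hl.1
      have key : listProd φ l * of h * (listProd φ l)⁻¹ =
          listProd φ l.dropLast * of h' * (listProd φ l.dropLast)⁻¹ := by
        have h1 : of h' = (t : HNNExtension G A B φ) ^ (b.1 : ℤ) * of (b.2 * h * b.2⁻¹) *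
            ((t : HNNExtension G A B φ) ^ (b.1 : ℤ))⁻¹ := eq_mul_inv_of_mul_eq hh'.symm
        conv_lhs => rw [← hsplit]
        rw [h1]
        simp [mul_assoc]
      have key' : of g₀ * listProd φ l * of h * (listProd φ l)⁻¹ * (of g₀)⁻¹ =
          of g₀ * listProd φ l.dropLast * of h' * (listProd φ l.dropLast)⁻¹ * (of g₀)⁻¹ := by
        have := congrArg (fun z => of g₀ * (z * (of g₀)⁻¹)) key
        simp only [mul_assoc] at this ⊢
        exact this
      rw [key'] at hcomm ⊢
      exact ih _ hred (by simp [hn]) h' g₀ Q hQ hcomm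
    · cases l with
      | nil => exact absurd rfl hl0
      | cons a l =>
        have hmem : ∀ e : G, listProd φ (a :: l) * of h * (listProd φ (a :: l))⁻¹ * of e ∈
            halfTree φ a.1 := by
          intro e
          have h1 := inv_listProd_mul_mem (φ := φ) l a hl (of_notMem_halfTree e a.1)
          rw [← hb] at h1
          have h2 : of b.2 * (of h * ((listProd φ (a :: l))⁻¹ * of e)) ∉ halfTree φ (-b.1) := by
            intro h2
            have h3 : of (b.2 * h * b.2⁻¹) * (of b.2 * ((listProd φ (a :: l))⁻¹ * of e)) ∈
                halfTree φ (-b.1) := by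
              simpa [mul_assoc] using h2
            exact hbh (by simpa using (halfTree_inter h1 h3).2)
          have := listProd_mul_mem_halfTree l a hl (by rwa [← hb])
          simpa only [mul_assoc] using this
        have hQ' : ∀ q ∈ Q, ∃ c ∈ toSubgroup A B (-a.1), (of g₀)⁻¹ * q * of g₀ = of c := by
          intro q hq
          obtain ⟨c, rfl⟩ := hQ hq
          refine ⟨g₀⁻¹ * c * g₀, ?_, by simp⟩
          have h1 := hmem 1
          have h2 := hmem (g₀⁻¹ * c * g₀)
          have h3 := (hcomm _ hq).eq
          have h4 : of (g₀⁻¹ * c * g₀) * (listProd φ (a :: l) * of h * (listProd φ (a :: l))⁻¹ *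
              of 1) = listProd φ (a :: l) * of h * (listProd φ (a :: l))⁻¹ *
              of (g₀⁻¹ * c * g₀) := by
            have := congrArg (fun z => (of g₀)⁻¹ * z * of g₀) h3
            simpa [mul_assoc] using this
          rw [← h4] at h2
          exact (halfTree_inter h1 h2).2
        obtain ⟨s, hs⟩ : ∃ s : HNNExtension G A B φ, s = t ^ (a.1 : ℤ) := ⟨_, rfl⟩
        obtain ⟨x, hx1, hx2⟩ := ih l (List.isChain_cons.1 hl).2 (by simpa using hn) h a.2
          ((fun q => s⁻¹ * (of g₀)⁻¹ * q * of g₀ * s) '' Q) (by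
            rintro _ ⟨q, hq, rfl⟩
            obtain ⟨c, hc, hqc⟩ := hQ' q hq
            obtain ⟨c', -, hc'⟩ := exists_of_mul_zpow (φ := φ) hc
            refine ⟨c', ?_⟩
            rw [← hs] at hc'
            have : of c' = s⁻¹ * (of c * s) := by rw [hc']; simp
            rw [this, ← hqc]
            simp [mul_assoc]) (by
            rintro _ ⟨q, hq, rfl⟩
            have := (Commute.conj_iff (s⁻¹ * (of g₀)⁻¹)).2 (hcomm q hq)
            convert this using 1
            · simp [mul_assoc]
            · simp [mul_assoc, ← hs])
        refine ⟨x * (s⁻¹ * (of g₀)⁻¹), fun q hq => ?_, ?_⟩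
        · have := hx1 _ ⟨q, hq, rfl⟩
          simpa [mul_assoc] using this
        · convert hx2 using 1
          simp [mul_assoc, ← hs]

/-- Commuting elliptic elements have a common fixed point. -/
lemma joint_conj (Q : Set (HNNExtension G A B φ)) (p : HNNExtension G A B φ)
    (hQ : ∃ x : HNNExtension G A B φ,
      ∀ q ∈ Q, x * q * x⁻¹ ∈ (of : G →* HNNExtension G A B φ).range)
    (hp : ∃ x : HNNExtension G A B φ, x * p * x⁻¹ ∈ (of : G →* HNNExtension G A B φ).range)
    (hcomm : ∀ q ∈ Q, Commute q p) :
    ∃ x : HNNExtension G A B φ,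
      ∀ q ∈ insert p Q, x * q * x⁻¹ ∈ (of : G →* HNNExtension G A B φ).range := by
  obtain ⟨x, hx⟩ := hQ
  obtain ⟨y, h, hy⟩ := hp
  obtain ⟨g₀, l, hl, hgl⟩ := exists_reduced (x * y⁻¹)
  have key : x * p * x⁻¹ = of g₀ * listProd φ l * of h * (listProd φ l)⁻¹ * (of g₀)⁻¹ := by
    have : of g₀ * listProd φ l * of h * (listProd φ l)⁻¹ * (of g₀)⁻¹ =
      (x * y⁻¹) * of h * (x * y⁻¹)⁻¹ := by rw [hgl]; simp [mul_assoc]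
    rw [this, hy]
    simp [mul_assoc]
  obtain ⟨z, hz1, hz2⟩ := joint_conj_aux _ l hl rfl h g₀ ((fun q => x * q * x⁻¹) '' Q)
    (by rintro _ ⟨q, hq, rfl⟩; exact hx q hq)
    (by rintro _ ⟨q, hq, rfl⟩; rw [← key]; exact (Commute.conj_iff x).2 (hcomm q hq))
  refine ⟨z * x, ?_⟩
  rintro q (rfl | hq)
  · rw [← key] at hz2
    simpa [mul_assoc] using hz2
  · simpa [mul_assoc] using hz1 _ ⟨q, hq, rfl⟩

lemma joint_conj_finite (S : Set (HNNExtension G A B φ)) (hS : S.Finite)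
    (hell : ∀ p ∈ S, ∃ x : HNNExtension G A B φ,
      x * p * x⁻¹ ∈ (of : G →* HNNExtension G A B φ).range)
    (hcomm : ∀ p ∈ S, ∀ q ∈ S, Commute p q) :
    ∃ x : HNNExtension G A B φ,
      ∀ q ∈ S, x * q * x⁻¹ ∈ (of : G →* HNNExtension G A B φ).range := by
  induction S, hS using Set.Finite.induction_on with
  | empty => exact ⟨1, by simp⟩
  | @insert p Q _ _ ih =>
    exact joint_conj Q p (ih (fun q hq => hell q (.inr hq))
      (fun q hq r hr => hcomm q (.inr hq) r (.inr hr))) (hell p (.inl rfl))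
      (fun q hq => hcomm q (.inr hq) p (.inl rfl))

/-- If neither associated subgroup is everything, the base group is not contained in
any of its proper conjugates. -/
lemma mem_range_of_conj_le (hA : A ≠ ⊤) (hB : B ≠ ⊤) (x : HNNExtension G A B φ)
    (hx : ∀ g : G, x⁻¹ * of g * x ∈ (of : G →* HNNExtension G A B φ).range) :
    x ∈ (of : G →* HNNExtension G A B φ).range := by
  obtain ⟨g₀, l, hl, rfl⟩ := exists_reduced x
  cases l with
  | nil => exact ⟨g₀, by simp⟩
  | cons a l =>
    exfalso
    have hall : ∀ g, g ∈ toSubgroup A B (-a.1) := by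
      intro g
      obtain ⟨c, hc⟩ := hx (g₀ * g * g₀⁻¹)
      have h1 := listProd_mul_mem_halfTree (φ := φ) l a hl (x := 1)
        (by simpa using of_notMem_halfTree (φ := φ) _ _)
      have h2 := listProd_mul_mem_halfTree (φ := φ) l a hl (x := of c)
        (by rw [← map_mul]; exact of_notMem_halfTree (φ := φ) _ _)
      have h3 : of g * (listProd φ (a :: l) * 1) = listProd φ (a :: l) * of c := by
        rw [hc]
        simp [mul_assoc]
      rw [← h3] at h2
      exact (halfTree_inter h1 h2).2
    rcases Int.units_eq_one_or (-a.1) with h | h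
    · rw [h] at hall
      exact hA ((Subgroup.eq_top_iff' _).2 hall)
    · rw [h] at hall
      exact hB ((Subgroup.eq_top_iff' _).2 hall)

/-- If neither associated subgroup is everything, the HNN extension is not metabelian. -/
lemma exists_commutators_not_commute (hA : A ≠ ⊤) (hB : B ≠ ⊤) :
    ∃ x₁ x₂ y₁ y₂ : HNNExtension G A B φ, ¬ Commute (x₁ * x₂ * x₁⁻¹ * x₂⁻¹) (y₁ * y₂ * y₁⁻¹ * y₂⁻¹) := by
  obtain ⟨a, -, ha⟩ := SetLike.exists_of_lt hA.lt_top
  obtain ⟨b, -, hb⟩ := SetLike.exists_of_lt hB.lt_top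
  have hra : IsReduced A B [(1, a), (-1, a⁻¹)] :=
    List.isChain_pair.2 fun h => absurd h ha
  have hrb : IsReduced A B [(-1, b), (1, b⁻¹)] :=
    List.isChain_pair.2 fun h => absurd h hb
  have hla : listProd φ [(1, a), (-1, a⁻¹)] =
      (t : HNNExtension G A B φ) * of a * t⁻¹ * (of a)⁻¹ := by
    simp [mul_assoc]
  have hlb : listProd φ [(-1, b), (1, b⁻¹)] =
      (t : HNNExtension G A B φ)⁻¹ * of b * t⁻¹⁻¹ * (of b)⁻¹ := by
    simp [mul_assoc]
  refine ⟨t, of a, t⁻¹, of b, fun hc => ?_⟩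
  have h1 := listProd_mul_mem_halfTree (φ := φ) _ _ hra (x := 1)
    (by simpa using of_notMem_halfTree (φ := φ) (a⁻¹) 1)
  have h2 := listProd_mul_mem_halfTree (φ := φ) _ _ hrb (x := 1)
    (by simpa using of_notMem_halfTree (φ := φ) (b⁻¹) (-1))
  have h3 := listProd_mul_mem_halfTree (φ := φ) _ _ hra
    (x := listProd φ [(-1, b), (1, b⁻¹)] * 1)
    (fun h => absurd (halfTree_inter h2 h).1 (by simp))
  have h4 := listProd_mul_mem_halfTree (φ := φ) _ _ hrb
    (x := listProd φ [(1, a), (-1, a⁻¹)] * 1)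
    (fun h => absurd (halfTree_inter h1 h).1 (by simp))
  rw [hla, hlb] at h3 h4
  rw [mul_one, hc.eq] at h3
  rw [mul_one] at h4
  have := halfTree_inter (g := 1) h3 (by simpa using h4)
  exact absurd this.1 (by simp)

end HNNExtension

namespace HNNExtension
variable {G : Type*} [CommGroup G] {A B : Subgroup G} {φ : A ≃* B}

/-- A base element fixed by a descending path lies in the domains of the iterates of `φ`. -/
lemma mem_of_commute_listProd {V : Type*} (a : Equiv.Perm V) (α : G → V)
    (hα : ∀ x : A, α (φ x : G) = a (α x)) (l : List (ℤˣ × G)) (hl : IsReduced A B l)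
    (v v' : G) (h : of v * listProd φ l = listProd φ l * of v') (i : ℕ)
    (hi : (i : ℤ) < -(l.map fun x => (x.1 : ℤ)).sum) :
    ∃ w : A, α w = (a ^ (i : ℤ)) (α v) := by
  induction l generalizing v i with
  | nil => simp at hi; omega
  | cons b l ih =>
    have hv : v ∈ toSubgroup A B (-b.1) := by
      have h1 := listProd_mul_mem_halfTree (φ := φ) l b hl (x := 1)
        (by simpa using of_notMem_halfTree (φ := φ) _ _)
      have h2 := listProd_mul_mem_halfTree (φ := φ) l b hl (x := of v')
        (by rw [← map_mul]; exact of_notMem_halfTree (φ := φ) _ _)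
      rw [← h, ← mul_one (listProd φ _)] at h2
      exact (halfTree_inter h1 h2).2
    have hl' : IsReduced A B l := (List.isChain_cons.1 hl).2
    obtain ⟨u, g⟩ := b
    have hstep : ∀ v₁ : G, (of v * t ^ (u : ℤ) : HNNExtension G A B φ) = t ^ (u : ℤ) * of v₁ →
        of v₁ * listProd φ l = listProd φ l * of v' := by
      intro v₁ hv₁
      rw [listProd_cons, ← mul_assoc, ← mul_assoc, hv₁, mul_assoc (t ^ (u : ℤ)), ← map_mul,
        mul_comm v₁, map_mul] at h
      simpa [mul_assoc] using h
    rcases Int.units_eq_one_or u with rfl | rfl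
    · have hvB : v ∈ B := hv
      have h1 := hstep (φ.symm ⟨v, hvB⟩) (by
        simpa using of_mul_t (φ := φ) ⟨v, hvB⟩)
      obtain ⟨w, hw⟩ := ih hl' _ h1 (i + 1) (by simp at hi ⊢; omega)
      refine ⟨w, ?_⟩
      have h2 := hα (φ.symm ⟨v, hvB⟩)
      rw [MulEquiv.apply_symm_apply] at h2
      simp only at h2
      rw [hw, h2, ← Equiv.Perm.mul_apply, ← _root_.zpow_add_one]
      push_cast
      rfl
    · have hvA : v ∈ A := by simpa using hv
      cases i with
      | zero => exact ⟨⟨v, hvA⟩, by simp⟩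
      | succ i =>
        have h1 := hstep (φ ⟨v, hvA⟩) (by
          simpa using of_mul_inv_t (φ := φ) ⟨v, hvA⟩)
        obtain ⟨w, hw⟩ := ih hl' _ h1 i (by simp at hi ⊢; omega)
        refine ⟨w, ?_⟩
        rw [hw, hα ⟨v, hvA⟩, ← Equiv.Perm.mul_apply, ← _root_.zpow_add_one]
        push_cast
        rfl

end HNNExtension

/-! ### Basic facts on Leary–Minasyan groups -/

section Commuting

variable {P : Type*} [Group P]

lemma List.prod_ofFn_zpow_add {n : ℕ} (g : Fin n → P) (hg : ∀ i j, Commute (g i) (g j))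
    (v w : Fin n → ℤ) :
    (List.ofFn fun i => g i ^ (v + w) i).prod =
      (List.ofFn fun i => g i ^ v i).prod * (List.ofFn fun i => g i ^ w i).prod := by
  induction n with
  | zero => simp
  | succ n ih =>
    simp only [List.ofFn_succ, List.prod_cons]
    have h := ih (fun i => g i.succ) (fun i j => hg _ _) (fun i => v i.succ) (fun i => w i.succ)
    simp only [Pi.add_apply] at h ⊢
    rw [h, _root_.zpow_add]
    have hc : Commute (g 0 ^ w 0) (List.ofFn fun i : Fin n => g i.succ ^ v i.succ).prod := by
      refine Commute.list_prod_right _ _ fun x hx => ?_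
      obtain ⟨i, rfl⟩ := (List.mem_ofFn' _ _).1 hx
      exact (hg _ _).zpow_zpow _ _
    simp only [mul_assoc]
    rw [← mul_assoc (g 0 ^ w 0), hc.eq]
    simp only [mul_assoc]

lemma prod_ofFn_mulSingle {n : ℕ} (i : Fin n) (x : P) :
    (List.ofFn (Pi.mulSingle i x : Fin n → P)).prod = x := by
  induction n with
  | zero => exact i.elim0
  | succ n ih =>
    rw [List.ofFn_succ, List.prod_cons]
    refine Fin.cases ?_ (fun j => ?_) i
    · have : (fun k : Fin n => (Pi.mulSingle 0 x : Fin (n + 1) → P) k.succ) = fun _ => 1 := by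
        ext k
        simp
      rw [this]
      simp
    · have : (fun k : Fin n => (Pi.mulSingle j.succ x : Fin (n + 1) → P) k.succ) =
          Pi.mulSingle j x := by
        ext k
        simp [Pi.mulSingle_apply]
      rw [this, ih]
      simp [(Fin.succ_ne_zero j).symm]

lemma map_ofAdd_eq_prod {n : ℕ} (ψ : Multiplicative (Fin n → ℤ) →* P) (v : Fin n → ℤ) :
    (List.ofFn fun i => ψ (.ofAdd (Pi.single i 1)) ^ v i).prod = ψ (.ofAdd v) := by
  have h : Multiplicative.ofAdd v =
      (List.ofFn fun i => (Multiplicative.ofAdd (Pi.single i (1 : ℤ) : Fin n → ℤ)) ^ v i).prod := by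
    rw [List.prod_ofFn]
    apply Multiplicative.toAdd.injective
    rw [toAdd_prod]
    simp only [toAdd_ofAdd, toAdd_zpow, ← Pi.single_smul, smul_eq_mul, mul_one]
    exact (Finset.univ_sum_single v).symm
  rw [h, map_list_prod, List.map_ofFn]
  congr 2
  ext i
  simp

end Commuting

@[simp] lemma ZtoQ_apply {n : ℕ} (v : Fin n → ℤ) (i : Fin n) : ZtoQ n v i = v i := rfl

lemma ZtoQ_injective (n : ℕ) : Function.Injective (ZtoQ n) := fun v w h => by
  ext i
  simpa using congrFun h i

lemma mem_ALsub {n : ℕ} {A : Matrix (Fin n) (Fin n) ℚ} {L : AddSubgroup (Fin n → ℤ)}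
    {w : Fin n → ℤ} : w ∈ ALsub A L ↔ ∃ v ∈ L, A *ᵥ ZtoQ n v = ZtoQ n w := by
  simp [ALsub, QImage, AddSubgroup.mem_map]

lemma QImage_le_iff {n : ℕ} {A : Matrix (Fin n) (Fin n) ℚ} {L : AddSubgroup (Fin n → ℤ)} :
    QImage A L ≤ (ZtoQ n).range ↔ ∀ v ∈ L, ∃ w, ZtoQ n w = A *ᵥ ZtoQ n v := by
  constructor
  · intro h v hv
    exact h ⟨ZtoQ n v, ⟨v, hv, rfl⟩, rfl⟩
  · rintro h _ ⟨_, ⟨v, hv, rfl⟩, rfl⟩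
    exact h v hv

namespace LM

variable {n : ℕ} {A : Matrix (Fin n) (Fin n) ℚ} {L : AddSubgroup (Fin n → ℤ)}

lemma commute_Xg (i j : Fin n) : Commute (Xg n A L i) (Xg n A L j) := by
  have : (PresentedGroup.mk (LMrels n A L)) (FreeGroup.of (Sum.inl i) * FreeGroup.of (Sum.inl j) *
              (FreeGroup.of (Sum.inl i))⁻¹ * (FreeGroup.of (Sum.inl j))⁻¹) = 1 :=
    PresentedGroup.one_of_mem (.inl ⟨i, j, rfl⟩)
  simp only [map_mul, map_inv] at this
  rw [mul_inv_eq_one, mul_inv_eq_iff_eq_mul] at this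
  exact this

lemma Xv_add (v w : Fin n → ℤ) : Xv n A L (v + w) = Xv n A L v * Xv n A L w :=
  List.prod_ofFn_zpow_add _ commute_Xg v w

variable (A L) in
/-- The base group homomorphism `v ↦ x^v`. -/
def base : Multiplicative (Fin n → ℤ) →* LM n A L :=
  MonoidHom.mk' (fun v => Xv n A L v.toAdd) fun v w => Xv_add v.toAdd w.toAdd

@[simp] lemma Xv_zero : Xv n A L 0 = 1 := map_one (base A L)

lemma Xv_neg (v : Fin n → ℤ) : Xv n A L (-v) = (Xv n A L v)⁻¹ := map_inv (base A L) (.ofAdd v)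

lemma Xv_sub (v w : Fin n → ℤ) : Xv n A L (v - w) = Xv n A L v * (Xv n A L w)⁻¹ := by
  rw [sub_eq_add_neg, Xv_add, Xv_neg]

lemma Xv_zsmul (k : ℤ) (v : Fin n → ℤ) : Xv n A L (k • v) = Xv n A L v ^ k :=
  map_zpow (base A L) (.ofAdd v) k

lemma Xv_nsmul (k : ℕ) (v : Fin n → ℤ) : Xv n A L (k • v) = Xv n A L v ^ k :=
  map_pow (base A L) (.ofAdd v) k

lemma Xv_commute (v w : Fin n → ℤ) : Commute (Xv n A L v) (Xv n A L w) := by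
  rw [Commute, SemiconjBy, ← Xv_add, add_comm, Xv_add]

lemma Xv_single (i : Fin n) : Xv n A L (Pi.single i 1) = Xg n A L i := by
  have h : (fun j => Xg n A L j ^ ((Pi.single i 1 : Fin n → ℤ) j)) =
      Pi.mulSingle i (Xg n A L i) := by
    ext j
    by_cases hj : j = i
    · subst hj; simp
    · simp [hj]
  rw [Xv, h]
  exact prod_ofFn_mulSingle i _

lemma mk_xWord (v : Fin n → ℤ) : PresentedGroup.mk (LMrels n A L) (xWord n v) = Xv n A L v := by
  rw [xWord, map_list_prod, List.map_ofFn, Xv]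
  congr 2

lemma Tg_mul_Xv {v w : Fin n → ℤ} (hv : v ∈ L) (h : ZtoQ n w = A *ᵥ ZtoQ n v) :
    Tg n A L * Xv n A L v = Xv n A L w * Tg n A L := by
  have : PresentedGroup.mk (LMrels n A L) (FreeGroup.of (Sum.inr ()) * xWord n v *
      (FreeGroup.of (Sum.inr ()))⁻¹ * (xWord n w)⁻¹) = 1 :=
    PresentedGroup.one_of_mem (.inr ⟨v, hv, w, h, rfl⟩)
  simp only [map_mul, map_inv, mk_xWord] at this
  rw [mul_inv_eq_one, mul_inv_eq_iff_eq_mul] at this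
  exact this

variable {P : Type*} [Group P]

/-- The universal property of the Leary–Minasyan group. -/
def lift (ψ : Multiplicative (Fin n → ℤ) →* P) (τ : P)
    (h : ∀ v ∈ L, ∀ w, ZtoQ n w = A *ᵥ ZtoQ n v → τ * ψ (.ofAdd v) = ψ (.ofAdd w) * τ) :
    LM n A L →* P :=
  PresentedGroup.toGroup (f := Sum.elim (fun i => ψ (.ofAdd (Pi.single i 1))) (fun _ => τ)) (by
    have hx : ∀ v : Fin n → ℤ, FreeGroup.lift (Sum.elim
        (fun i => ψ (.ofAdd (Pi.single i 1))) (fun _ => τ)) (xWord n v) = ψ (.ofAdd v) := by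
      intro v
      rw [← map_ofAdd_eq_prod, xWord, map_list_prod, List.map_ofFn]
      congr 2
      ext i
      simp
    rintro r (⟨i, j, rfl⟩ | ⟨v, hv, w, hw, rfl⟩)
    · simp only [map_mul, map_inv, FreeGroup.lift_apply_of, Sum.elim_inl]
      rw [mul_inv_eq_one, mul_inv_eq_iff_eq_mul, ← map_mul, mul_comm, map_mul]
    · simp only [map_mul, map_inv, FreeGroup.lift_apply_of, Sum.elim_inr, hx]
      rw [mul_inv_eq_one, mul_inv_eq_iff_eq_mul]
      exact h v hv w hw)

@[simp] lemma lift_Tg (ψ : Multiplicative (Fin n → ℤ) →* P) (τ : P)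
    (h : ∀ v ∈ L, ∀ w, ZtoQ n w = A *ᵥ ZtoQ n v → τ * ψ (.ofAdd v) = ψ (.ofAdd w) * τ) :
    lift ψ τ h (Tg n A L) = τ := by
  simp [lift, Tg]

@[simp] lemma lift_Xv (ψ : Multiplicative (Fin n → ℤ) →* P) (τ : P)
    (h : ∀ v ∈ L, ∀ w, ZtoQ n w = A *ᵥ ZtoQ n v → τ * ψ (.ofAdd v) = ψ (.ofAdd w) * τ)
    (v : Fin n → ℤ) : lift ψ τ h (Xv n A L v) = ψ (.ofAdd v) := by
  rw [← map_ofAdd_eq_prod, Xv, map_list_prod, List.map_ofFn]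
  congr 2
  ext i
  simp [lift, Xg]

lemma hom_ext {f g : LM n A L →* P} (hX : ∀ v, f (Xv n A L v) = g (Xv n A L v))
    (hT : f (Tg n A L) = g (Tg n A L)) : f = g := by
  refine PresentedGroup.ext ?_
  rintro (i | ⟨⟩)
  · have := hX (Pi.single i 1)
    rwa [Xv_single] at this
  · exact hT

lemma induction_mul {p : LM n A L → Prop} (hX : ∀ v, p (Xv n A L v)) (hT : p (Tg n A L))
    (hT' : p (Tg n A L)⁻¹) (hmul : ∀ g h, p g → p h → p (g * h)) (g : LM n A L) : p g := by
  induction g using PresentedGroup.induction_on with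
  | _ z =>
  induction z using FreeGroup.induction_on with
  | C1 => simpa using hX 0
  | of i =>
    rcases i with i | ⟨⟩
    · have := hX (Pi.single i 1)
      rwa [Xv_single] at this
    · exact hT
  | inv_of i _ =>
    rcases i with i | ⟨⟩
    · have := hX (-Pi.single i 1)
      rwa [Xv_neg, Xv_single] at this
    · exact hT'
  | mul x y hx hy => rw [map_mul]; exact hmul _ _ hx hy

end LM

/-! ### The affine representation -/

section Act

variable {n : ℕ} {R : Type*} [CommRing R] (a : GL (Fin n) R)

/-- The action of `a ^ j` on `R^n`. -/
def act (j : ℤ) : (Fin n → R) →ₗ[R] (Fin n → R) :=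
  ((a ^ j : GL (Fin n) R) : Matrix (Fin n) (Fin n) R).mulVecLin

lemma act_apply (j : ℤ) (v : Fin n → R) :
    act a j v = ((a ^ j : GL (Fin n) R) : Matrix (Fin n) (Fin n) R) *ᵥ v := rfl

@[simp] lemma act_zero (v : Fin n → R) : act a 0 v = v := by simp [act_apply]

@[simp] lemma act_one (v : Fin n → R) :
    act a 1 v = (a : Matrix (Fin n) (Fin n) R) *ᵥ v := by simp [act_apply]

@[simp] lemma act_act (i j : ℤ) (v : Fin n → R) : act a i (act a j v) = act a (i + j) v := by
  simp [act_apply, _root_.zpow_add, Matrix.mulVec_mulVec]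

@[simp] lemma act_inv (j : ℤ) (v : Fin n → R) : act a⁻¹ j v = act a (-j) v := by
  rw [act_apply, act_apply, _root_.inv_zpow, _root_.zpow_neg]

lemma act_injective (j : ℤ) : Function.Injective (act a j) := fun v w h => by
  simpa using congrArg (act a (-j)) h

end Act

/-- Pairs `(v, j)` standing for the affine map `x ↦ v + a ^ j x`. -/
@[ext] structure Aff {n : ℕ} (a : GL (Fin n) ℚ) where
  /-- the translation part -/
  vec : Fin n → ℚ
  /-- the exponent of the linear part -/
  exp : ℤ

namespace Aff

variable {n : ℕ} (a : GL (Fin n) ℚ)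

instance : Mul (Aff a) := ⟨fun x y => ⟨x.vec + act a x.exp y.vec, x.exp + y.exp⟩⟩
instance : One (Aff a) := ⟨⟨0, 0⟩⟩
instance : Inv (Aff a) := ⟨fun x => ⟨-act a (-x.exp) x.vec, -x.exp⟩⟩

variable {a}

@[simp] lemma vec_mul (x y : Aff a) : (x * y).vec = x.vec + act a x.exp y.vec := rfl
@[simp] lemma exp_mul (x y : Aff a) : (x * y).exp = x.exp + y.exp := rfl
@[simp] lemma vec_one : (1 : Aff a).vec = 0 := rfl
@[simp] lemma exp_one : (1 : Aff a).exp = 0 := rfl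
@[simp] lemma vec_inv (x : Aff a) : (x⁻¹).vec = -act a (-x.exp) x.vec := rfl
@[simp] lemma exp_inv (x : Aff a) : (x⁻¹).exp = -x.exp := rfl

instance : Group (Aff a) := Group.ofLeftAxioms
  (fun x y z => by ext <;> simp [add_assoc])
  (fun x => by ext <;> simp)
  (fun x => by ext <;> simp)

@[simp] lemma mk_zero_one_zpow (j : ℤ) : (⟨0, 1⟩ : Aff a) ^ j = ⟨0, j⟩ := by
  induction j with
  | zero => rfl
  | succ j ih => rw [_root_.zpow_add_one, ih]; ext <;> simp
  | pred j ih => rw [_root_.zpow_sub_one, ih]; ext <;> simp; ring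

end Aff

namespace LM

section Height

variable {n : ℕ} {A : Matrix (Fin n) (Fin n) ℚ} {L : AddSubgroup (Fin n → ℤ)}

variable (A L) in
/-- The homomorphism to `ℤ` killing the base and sending `t` to `1`. -/
def heightHom : LM n A L →* Multiplicative ℤ :=
  lift 1 (.ofAdd 1) fun _ _ _ _ => by simp

/-- The exponent sum of `t`. -/
def height (g : LM n A L) : ℤ := (heightHom A L g).toAdd

@[simp] lemma height_mul (g h : LM n A L) : height (g * h) = height g + height h := by
  simp [height]
@[simp] lemma height_one : height (1 : LM n A L) = 0 := by simp [height]
@[simp] lemma height_inv (g : LM n A L) : height g⁻¹ = -height g := by simp [height]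
@[simp] lemma height_zpow (g : LM n A L) (k : ℤ) : height (g ^ k) = k * height g := by
  simp [height]
@[simp] lemma height_Xv (v : Fin n → ℤ) : height (Xv n A L v) = 0 := by simp [height, heightHom]
@[simp] lemma height_Tg : height (Tg n A L) = 1 := by simp [height, heightHom]

/-- A homomorphism to `ℤ` killing the base is a multiple of the height. -/
lemma eq_height_of_Xv {χ : LM n A L →* Multiplicative ℤ} (hχ : ∀ v, χ (Xv n A L v) = 1)
    (g : LM n A L) : (χ g).toAdd = (χ (Tg n A L)).toAdd * height g := by
  induction g using induction_mul with
  | hX v => simp [hχ]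
  | hT => simp
  | hT' => simp
  | hmul g h hg hh => simp [hg, hh, mul_add]

end Height

variable {n : ℕ} (a : GL (Fin n) ℚ) (L : AddSubgroup (Fin n → ℤ))

/-- The affine representation of the Leary–Minasyan group. -/
def rho : LM n (a : Matrix (Fin n) (Fin n) ℚ) L →* Aff a :=
  lift (MonoidHom.mk' (fun v => ⟨ZtoQ n v.toAdd, 0⟩) (fun v w => by ext <;> simp)) ⟨0, 1⟩
    (fun v _ w hw => by ext <;> simp [hw])

@[simp] lemma rho_Xv (v : Fin n → ℤ) : rho a L (Xv n _ L v) = ⟨ZtoQ n v, 0⟩ := by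
  simp [rho]

@[simp] lemma rho_Tg : rho a L (Tg n _ L) = ⟨0, 1⟩ := by simp [rho]

variable {a L}

@[simp] lemma rho_exp (g : LM n (a : Matrix (Fin n) (Fin n) ℚ) L) :
    (rho a L g).exp = height g := by
  induction g using induction_mul with
  | hX v => simp
  | hT => simp
  | hT' => simp
  | hmul g h hg hh => simp [hg, hh]

lemma Xv_injective : Function.Injective (Xv n (a : Matrix (Fin n) (Fin n) ℚ) L) := fun v w h => by
  have := congrArg (fun g => (rho a L g).vec) h
  exact ZtoQ_injective n (by simpa using this)

lemma rho_Tg_zpow (j : ℤ) : rho a L (Tg n _ L ^ j) = ⟨0, j⟩ := by simp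

end LM

namespace LM

section Equivs

/-- An isomorphism of the defining data induces an isomorphism of groups. -/
lemma nonempty_equiv_of_data {n m : ℕ} {A : Matrix (Fin n) (Fin n) ℚ}
    {L : AddSubgroup (Fin n → ℤ)} {A' : Matrix (Fin m) (Fin m) ℚ} {L' : AddSubgroup (Fin m → ℤ)}
    (b : (Fin n → ℤ) ≃+ (Fin m → ℤ)) (hL : ∀ v, b v ∈ L' ↔ v ∈ L)
    (hA : ∀ v w, ZtoQ n w = A *ᵥ ZtoQ n v ↔ ZtoQ m (b w) = A' *ᵥ ZtoQ m (b v)) :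
    ∃ f : LM n A L ≃* LM m A' L', (∀ v, f (Xv n A L v) = Xv m A' L' (b v)) ∧
      f (Tg n A L) = Tg m A' L' := by
  let f : LM n A L →* LM m A' L' :=
    lift ((base A' L').comp b.toAddMonoidHom.toMultiplicative) (Tg m A' L') fun v hv w hw =>
      Tg_mul_Xv ((hL v).2 hv) ((hA v w).1 hw)
  let g : LM m A' L' →* LM n A L :=
    lift ((base A L).comp b.symm.toAddMonoidHom.toMultiplicative) (Tg n A L) fun v hv w hw =>
      Tg_mul_Xv ((hL _).1 (by simpa using hv)) ((hA _ _).2 (by simpa using hw))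
  have hfX : ∀ v, f (Xv n A L v) = Xv m A' L' (b v) := fun v => lift_Xv _ _ _ v
  have hgX : ∀ v, g (Xv m A' L' v) = Xv n A L (b.symm v) := fun v => lift_Xv _ _ _ v
  have hfT : f (Tg n A L) = Tg m A' L' := lift_Tg _ _ _
  have hgT : g (Tg m A' L') = Tg n A L := lift_Tg _ _ _
  refine ⟨MonoidHom.toMulEquiv f g ?_ ?_, hfX, hfT⟩
  · exact hom_ext (fun v => by simp [hfX, hgX]) (by simp [hfT, hgT])
  · exact hom_ext (fun v => by simp [hfX, hgX]) (by simp [hfT, hgT])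

variable {n : ℕ} (a : GL (Fin n) ℚ) (L : AddSubgroup (Fin n → ℤ))

/-- Exchanging the two associated subgroups. -/
lemma nonempty_equiv_inv :
    ∃ f : LM n (a : Matrix (Fin n) (Fin n) ℚ) L ≃*
        LM n ((a⁻¹ : GL (Fin n) ℚ) : Matrix (Fin n) (Fin n) ℚ) (ALsub a L),
      (∀ v, f (Xv n _ L v) = Xv n _ _ v) ∧ f (Tg n _ L) = (Tg n _ _)⁻¹ := by
  have hinv : ∀ v w : Fin n → ℚ, w = ((a⁻¹ : GL (Fin n) ℚ) : Matrix (Fin n) (Fin n) ℚ) *ᵥ v ↔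
      v = (a : Matrix (Fin n) (Fin n) ℚ) *ᵥ w := by
    intro v w
    constructor <;> rintro rfl <;> simp [Matrix.mulVec_mulVec]
  let f : LM n (a : Matrix (Fin n) (Fin n) ℚ) L →*
      LM n ((a⁻¹ : GL (Fin n) ℚ) : Matrix (Fin n) (Fin n) ℚ) (ALsub a L) :=
    lift (base _ _) (Tg n _ _)⁻¹ fun v hv w hw => by
      rw [inv_mul_eq_iff_eq_mul, ← mul_assoc, eq_mul_inv_iff_mul_eq]
      exact (Tg_mul_Xv (mem_ALsub.2 ⟨v, hv, hw.symm⟩) ((hinv _ _).2 hw)).symm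
  let g : LM n ((a⁻¹ : GL (Fin n) ℚ) : Matrix (Fin n) (Fin n) ℚ) (ALsub a L) →*
      LM n (a : Matrix (Fin n) (Fin n) ℚ) L :=
    lift (base _ _) (Tg n _ _)⁻¹ fun v hv w hw => by
      rw [inv_mul_eq_iff_eq_mul, ← mul_assoc, eq_mul_inv_iff_mul_eq]
      rw [hinv] at hw
      obtain ⟨v', hv', h⟩ := mem_ALsub.1 hv
      obtain rfl : v' = w := by
        apply ZtoQ_injective
        rw [hw] at h
        exact act_injective a 1 (by simpa using h)
      exact (Tg_mul_Xv hv' hw).symm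
  have hfX : ∀ v, f (Xv n _ L v) = Xv n _ _ v := fun v => lift_Xv _ _ _ v
  have hgX : ∀ v, g (Xv n _ _ v) = Xv n _ _ v := fun v => lift_Xv _ _ _ v
  have hfT : f (Tg n _ _) = (Tg n _ _)⁻¹ := lift_Tg _ _ _
  have hgT : g (Tg n _ _) = (Tg n _ _)⁻¹ := lift_Tg _ _ _
  refine ⟨MonoidHom.toMulEquiv f g ?_ ?_, hfX, hfT⟩
  · exact hom_ext (fun v => by simp [hfX, hgX]) (by simp [hfT, hgT])
  · exact hom_ext (fun v => by simp [hfX, hgX]) (by simp [hfT, hgT])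

end Equivs

end LM

namespace LM

section HNN

variable {n : ℕ} {a : GL (Fin n) ℚ} {L : AddSubgroup (Fin n → ℤ)}

/-- The Leary–Minasyan group as an HNN extension. -/
lemma exists_equiv_hnn (hLA : QImage (a : Matrix (Fin n) (Fin n) ℚ) L ≤ (ZtoQ n).range) :
    ∃ (φ : L.toSubgroup ≃* (ALsub (a : Matrix (Fin n) (Fin n) ℚ) L).toSubgroup)
      (e : LM n (a : Matrix (Fin n) (Fin n) ℚ) L ≃* HNNExtension _ _ _ φ),
      (∀ v, ZtoQ n (φ v : Multiplicative (Fin n → ℤ)).toAdd =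
        act a 1 (ZtoQ n (v : Multiplicative (Fin n → ℤ)).toAdd)) ∧
      (∀ v, e (Xv n _ L v) = HNNExtension.of (.ofAdd v)) ∧ e (Tg n _ L) = HNNExtension.t := by
  rw [QImage_le_iff] at hLA
  choose! F hF using hLA
  let φ₀ : L.toSubgroup →* (ALsub (a : Matrix (Fin n) (Fin n) ℚ) L).toSubgroup :=
    MonoidHom.mk' (fun v => ⟨.ofAdd (F v.1.toAdd), mem_ALsub.2 ⟨_, v.2, (hF _ v.2).symm⟩⟩) (by
      intro v w
      ext1
      apply Multiplicative.toAdd.injective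
      apply ZtoQ_injective
      have h1 := hF v.1.toAdd v.2
      have h2 := hF w.1.toAdd w.2
      have h3 := hF (v.1.toAdd + w.1.toAdd) (L.add_mem v.2 w.2)
      simp only [Subgroup.coe_mul, toAdd_mul, toAdd_ofAdd, map_add, mulVec_add] at h3 ⊢
      rw [h3, h1, h2])
  have hφ₀ : ∀ v, ZtoQ n (φ₀ v : Multiplicative (Fin n → ℤ)).toAdd =
        act a 1 (ZtoQ n (v : Multiplicative (Fin n → ℤ)).toAdd) := fun v => by
    rw [act_one]
    exact hF _ v.2
  have hbij : Function.Bijective φ₀ := by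
    constructor
    · intro v w h
      have := hφ₀ v
      rw [h, hφ₀ w] at this
      exact Subtype.ext (Multiplicative.toAdd.injective (ZtoQ_injective _
        (act_injective a 1 this.symm)))
    · rintro ⟨w, hw⟩
      obtain ⟨v, hv, h⟩ := mem_ALsub.1 hw
      refine ⟨⟨.ofAdd v, hv⟩, Subtype.ext (Multiplicative.toAdd.injective (ZtoQ_injective _ ?_))⟩
      rw [hφ₀, act_one]
      exact h
  let φ := MulEquiv.ofBijective φ₀ hbij
  have hφ : ∀ v, ZtoQ n (φ v : Multiplicative (Fin n → ℤ)).toAdd =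
        act a 1 (ZtoQ n (v : Multiplicative (Fin n → ℤ)).toAdd) := hφ₀
  let f : LM n (a : Matrix (Fin n) (Fin n) ℚ) L →* HNNExtension _ _ _ φ :=
    lift HNNExtension.of HNNExtension.t fun v hv w hw => by
      have h := HNNExtension.t_mul_of (φ := φ) ⟨.ofAdd v, hv⟩
      rw [h]
      congr 2
      apply Multiplicative.toAdd.injective
      apply ZtoQ_injective
      rw [hφ, act_one]
      exact hw.symm
  let g : HNNExtension _ _ _ φ →* LM n (a : Matrix (Fin n) (Fin n) ℚ) L :=
    HNNExtension.lift (base _ _) (Tg n _ _) fun v => by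
      refine Tg_mul_Xv v.2 ?_
      have := hφ v
      rwa [act_one] at this
  have hfX : ∀ v, f (Xv n _ L v) = HNNExtension.of (.ofAdd v) := fun v => lift_Xv _ _ _ v
  have hfT : f (Tg n _ L) = HNNExtension.t := lift_Tg _ _ _
  have hgX : ∀ v, g (HNNExtension.of v) = Xv n _ L v.toAdd := fun v => HNNExtension.lift_of _ _ _ v
  have hgT : g HNNExtension.t = Tg n _ L := HNNExtension.lift_t _ _ _
  refine ⟨φ, MonoidHom.toMulEquiv f g ?_ ?_, hφ, hfX, hfT⟩
  · exact hom_ext (fun v => by simp [hfX, hgX]) (by simp [hfT, hgT])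
  · refine HNNExtension.hom_ext ?_ (by simp [hfT, hgT])
    ext v
    simp [hfX, hgX]

/-- The subgroup `L` is detected by the elements of height `-1`. -/
lemma mem_of_height_eq_neg_one (hLA : QImage (a : Matrix (Fin n) (Fin n) ℚ) L ≤ (ZtoQ n).range)
    {g : LM n (a : Matrix (Fin n) (Fin n) ℚ) L} (hg : height g = -1)
    {v v' : Fin n → ℤ} (h : Xv n _ L v * g = g * Xv n _ L v') : v ∈ L := by
  obtain ⟨φ, e, hφ, heX, heT⟩ := exists_equiv_hnn hLA
  obtain ⟨g₀, l, hl, hgl⟩ := HNNExtension.exists_reduced (e g)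
  have hheight : ∀ l, height (e.symm (HNNExtension.listProd φ l)) =
      (l.map fun x => (x.1 : ℤ)).sum := by
    intro l
    have hT : e.symm HNNExtension.t = Tg n _ L := by rw [← heT, e.symm_apply_apply]
    have hX : ∀ v, e.symm (HNNExtension.of v) = Xv n _ L v.toAdd := fun v => by
      rw [e.symm_apply_eq, heX]; rfl
    induction l with
    | nil => simp
    | cons b l ih => simp [ih, hT, hX]
  have h1 : HNNExtension.of (.ofAdd v) * HNNExtension.listProd φ l =
      HNNExtension.listProd φ l * HNNExtension.of (.ofAdd v') := by
    have := congrArg e h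
    rw [map_mul, map_mul, hgl, heX, heX, ← mul_assoc, ← map_mul, mul_comm, map_mul, mul_assoc,
      mul_assoc] at this
    exact mul_left_cancel this
  have h2 : (l.map fun x => (x.1 : ℤ)).sum = -1 := by
    rw [← hheight, ← hg]
    have : g = Xv n _ L g₀.toAdd * e.symm (HNNExtension.listProd φ l) := by
      apply e.injective
      rw [hgl, map_mul, heX, e.apply_symm_apply]; rfl
    conv_rhs => rw [this]
    simp
  obtain ⟨w, hw⟩ := HNNExtension.mem_of_commute_listProd
    (V := Fin n → ℚ) (⟨act a 1, act a (-1), fun x => (act_act a _ _ x).trans (by simp),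
      fun x => (act_act a _ _ x).trans (by simp)⟩)
    (fun v => ZtoQ n v.toAdd) hφ l hl (.ofAdd v) (.ofAdd v') h1 0 (by rw [h2]; simp)
  have : w.1.toAdd = v := ZtoQ_injective n (by simpa using hw)
  rw [← this]
  exact w.2

lemma toSubgroup_ne_top {L : AddSubgroup (Fin n → ℤ)} (hL : L ≠ ⊤) :
    AddSubgroup.toSubgroup L ≠ ⊤ := fun h =>
  hL (AddSubgroup.toSubgroup.injective (by rw [h]; exact (map_top AddSubgroup.toSubgroup).symm))

lemma mem_base_of_conj_le (hLA : QImage (a : Matrix (Fin n) (Fin n) ℚ) L ≤ (ZtoQ n).range)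
    (hL : L ≠ ⊤) (hAL : ALsub (a : Matrix (Fin n) (Fin n) ℚ) L ≠ ⊤)
    (x : LM n (a : Matrix (Fin n) (Fin n) ℚ) L)
    (hx : ∀ v, ∃ w, x⁻¹ * Xv n _ L v * x = Xv n _ L w) : ∃ w, x = Xv n _ L w := by
  obtain ⟨φ, e, -, heX, -⟩ := exists_equiv_hnn hLA
  obtain ⟨w, hw⟩ := HNNExtension.mem_range_of_conj_le (toSubgroup_ne_top hL)
    (toSubgroup_ne_top hAL) (e x) (fun g => by
      obtain ⟨w, hw⟩ := hx g.toAdd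
      refine ⟨.ofAdd w, ?_⟩
      rw [← heX, ← hw, map_mul, map_mul, heX, map_inv]
      rfl)
  exact ⟨w.toAdd, e.injective (by rw [← hw, heX]; rfl)⟩

lemma exists_commutators_not_commute
    (hLA : QImage (a : Matrix (Fin n) (Fin n) ℚ) L ≤ (ZtoQ n).range)
    (hL : L ≠ ⊤) (hAL : ALsub (a : Matrix (Fin n) (Fin n) ℚ) L ≠ ⊤) :
    ∃ x₁ x₂ y₁ y₂ : LM n (a : Matrix (Fin n) (Fin n) ℚ) L,
      ¬ Commute (x₁ * x₂ * x₁⁻¹ * x₂⁻¹) (y₁ * y₂ * y₁⁻¹ * y₂⁻¹) := by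
  obtain ⟨φ, e, -, heX, -⟩ := exists_equiv_hnn hLA
  obtain ⟨x₁, x₂, y₁, y₂, h⟩ := HNNExtension.exists_commutators_not_commute (φ := φ)
    (toSubgroup_ne_top hL) (toSubgroup_ne_top hAL)
  refine ⟨e.symm x₁, e.symm x₂, e.symm y₁, e.symm y₂, fun hc => h ?_⟩
  simpa using hc.map e

lemma exists_conj_mem_base (hLA : QImage (a : Matrix (Fin n) (Fin n) ℚ) L ≤ (ZtoQ n).range)
    (hL : L ≠ ⊤) (hAL : ALsub (a : Matrix (Fin n) (Fin n) ℚ) L ≠ ⊤) {m : ℕ}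
    (ψ : Multiplicative (Fin m → ℤ) →* LM n (a : Matrix (Fin n) (Fin n) ℚ) L)
    (hψ : ∀ v x, ∃ k : ℕ, 0 < k ∧ Commute (x * ψ v ^ k * x⁻¹) (ψ v)) :
    ∃ x, ∀ v, ∃ w, x * ψ v * x⁻¹ = Xv n _ L w := by
  obtain ⟨φ, e, -, heX, -⟩ := exists_equiv_hnn hLA
  have hcomm : ∀ v w, Commute (e (ψ v)) (e (ψ w)) := fun v w =>
    ((Commute.all v w).map ψ).map e
  obtain ⟨x, hx⟩ := HNNExtension.joint_conj_finite
    (Set.range fun i : Fin m => e (ψ (.ofAdd (Pi.single i 1)))) (Set.finite_range _)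
    (by
      rintro _ ⟨i, rfl⟩
      refine HNNExtension.elliptic_of_commute (toSubgroup_ne_top hL) (toSubgroup_ne_top hAL) _
        fun x => ?_
      obtain ⟨k, hk, h⟩ := hψ (.ofAdd (Pi.single i 1)) (e.symm x)
      refine ⟨k, hk, ?_⟩
      simpa using h.map e)
    (by rintro _ ⟨i, rfl⟩ _ ⟨j, rfl⟩; exact hcomm _ _)
  have key : ∀ v, x * e (ψ v) * x⁻¹ ∈ (HNNExtension.of : _ →* HNNExtension _ _ _ φ).range := by
    intro v
    have h : x * e (ψ v) * x⁻¹ = (((MulAut.conj x).toMonoidHom.comp e.toMonoidHom).comp ψ)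
        (.ofAdd v.toAdd) := rfl
    rw [h, ← map_ofAdd_eq_prod]
    refine Subgroup.list_prod_mem _ fun y hy => ?_
    obtain ⟨i, rfl⟩ := (List.mem_ofFn' _ _).1 hy
    exact Subgroup.zpow_mem _ (hx _ ⟨i, rfl⟩) _
  refine ⟨e.symm x, fun v => ?_⟩
  obtain ⟨w, hw⟩ := key v
  refine ⟨w.toAdd, e.injective ?_⟩
  rw [heX, map_mul, map_mul, map_inv, e.apply_symm_apply, ← hw]
  rfl

lemma exists_nsmul_eq_intCast (hL : L.FiniteIndex) (x : Fin n → ℚ) :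
    ∃ k : ℕ, k ≠ 0 ∧ ∃ v ∈ L, ZtoQ n v = k • x := by
  obtain ⟨d, hd⟩ := IsLocalization.exist_integer_multiples_of_finite (nonZeroDivisors ℤ) x
  choose z hz using hd
  have hd0 : (d : ℤ) ≠ 0 := nonZeroDivisors.ne_zero d.2
  have hz' : ZtoQ n z = (d : ℤ) • x := by
    ext i
    have := hz i
    simp only [eq_intCast] at this
    simpa [Algebra.smul_def] using this
  refine ⟨L.index * (d : ℤ).natAbs, mul_ne_zero hL.index_ne_zero (Int.natAbs_ne_zero.2 hd0),
    L.index • (d : ℤ).sign • z, L.nsmul_index_mem _, ?_⟩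
  rw [map_nsmul, map_zsmul, hz', mul_smul, smul_smul (d : ℤ).sign, Int.sign_mul_self_eq_natAbs,
    natCast_zsmul]

/-- The base group is commensurated. -/
lemma exists_conj_nsmul (hLA : QImage (a : Matrix (Fin n) (Fin n) ℚ) L ≤ (ZtoQ n).range)
    (hL : L.FiniteIndex) (y : LM n (a : Matrix (Fin n) (Fin n) ℚ) L) :
    ∀ v, ∃ k : ℕ, 0 < k ∧ ∃ w, y * Xv n _ L (k • v) * y⁻¹ = Xv n _ L w := by
  rw [QImage_le_iff] at hLA
  induction y using induction_mul with
  | hX u => exact fun v => ⟨1, one_pos, 1 • v, by rw [(Xv_commute _ _).eq, mul_inv_cancel_right]⟩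
  | hT =>
    intro v
    obtain ⟨w, hw⟩ := hLA _ (L.nsmul_index_mem v)
    exact ⟨L.index, Nat.pos_of_ne_zero hL.index_ne_zero, w, by
      rw [Tg_mul_Xv (L.nsmul_index_mem v) hw, mul_inv_cancel_right]⟩
  | hT' =>
    intro v
    obtain ⟨k, hk, z, hz, hzv⟩ := exists_nsmul_eq_intCast hL (act a (-1) (ZtoQ n v))
    refine ⟨k, Nat.pos_of_ne_zero hk, z, ?_⟩
    rw [inv_inv, mul_assoc, inv_mul_eq_iff_eq_mul]
    symm
    refine Tg_mul_Xv hz ?_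
    rw [← act_one, hzv, map_nsmul, map_nsmul, act_act, add_neg_cancel, act_zero]
  | hmul g h hg hh =>
    intro v
    obtain ⟨k, hk, w, hw⟩ := hh v
    obtain ⟨k', hk', w', hw'⟩ := hg w
    refine ⟨k' * k, Nat.mul_pos hk' hk, w', ?_⟩
    rw [← hw', mul_smul, Xv_nsmul, Xv_nsmul _ w, ← hw, conj_pow]
    simp [mul_assoc]

end HNN
end LM

namespace LM

section Comparison

variable {n m : ℕ} {a : GL (Fin n) ℚ} {a' : GL (Fin m) ℚ} {L : AddSubgroup (Fin n → ℤ)}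
  {L' : AddSubgroup (Fin m → ℤ)}

lemma height_eq_or_neg {A : Matrix (Fin n) (Fin n) ℚ} {A' : Matrix (Fin m) (Fin m) ℚ}
    (f : LM n A L ≃* LM m A' L') (hf : ∀ v, height (f (Xv n A L v)) = 0) :
    (∀ g, height (f g) = height g) ∨ ∀ g, height (f g) = -height g := by
  have h := eq_height_of_Xv (χ := (heightHom A' L').comp f.toMonoidHom) (fun v => by
    exact Multiplicative.toAdd.injective (hf v))
  have h' : ∀ g, height (f g) = height (f (Tg n A L)) * height g := h
  have hu : IsUnit (height (f (Tg n A L))) := by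
    refine IsUnit.of_mul_eq_one (height (f.symm (Tg m A' L'))) ?_
    rw [← h', f.apply_symm_apply, height_Tg]
  rcases Int.isUnit_iff.1 hu with hu | hu
  · exact .inl fun g => by rw [h', hu, one_mul]
  · exact .inr fun g => by rw [h', hu, neg_one_mul]

/-- Rational linear maps agreeing on a lattice are equal. -/
lemma linearMap_ext_of_lattice (hL : L.FiniteIndex) {V : Type*} [AddCommGroup V] [Module ℚ V]
    {f g : (Fin n → ℚ) →ₗ[ℚ] V} (h : ∀ v ∈ L, f (ZtoQ n v) = g (ZtoQ n v)) : f = g := by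
  refine LinearMap.ext fun x => ?_
  obtain ⟨k, hk, v, hv, hvx⟩ := exists_nsmul_eq_intCast hL x
  have := h v hv
  rw [hvx, map_nsmul, map_nsmul, ← Nat.cast_smul_eq_nsmul ℚ, ← Nat.cast_smul_eq_nsmul ℚ] at this
  exact smul_right_injective V (Nat.cast_ne_zero.2 hk) this

/-- An additive map `ℤ^n → V` extends to `ℚ^n`. -/
lemma exists_linearMap_extending {V : Type*} [AddCommGroup V] [Module ℚ V]
    (f : (Fin n → ℤ) →+ V) : ∃ B : (Fin n → ℚ) →ₗ[ℚ] V, ∀ v, B (ZtoQ n v) = f v := by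
  refine ⟨(Pi.basisFun ℚ (Fin n)).constr ℚ fun i => f (Pi.single i 1), fun v => ?_⟩
  rw [Module.Basis.constr_apply_fintype]
  conv_rhs => rw [← Finset.univ_sum_single v]
  rw [map_sum]
  refine Finset.sum_congr rfl fun i _ => ?_
  have : (Pi.single i (v i) : Fin n → ℤ) = v i • Pi.single i 1 := by
    rw [← Pi.single_smul, smul_eq_mul, mul_one]
  rw [this, map_zsmul]
  simp [Int.cast_smul_eq_zsmul]

lemma exists_linear_of_height (hL : L.FiniteIndex)
    (hLA : QImage (a : Matrix (Fin n) (Fin n) ℚ) L ≤ (ZtoQ n).range)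
    (f : LM n (a : Matrix (Fin n) (Fin n) ℚ) L →* LM m (a' : Matrix (Fin m) (Fin m) ℚ) L')
    (hf : ∀ g, height (f g) = height g) :
    ∃ B : (Fin n → ℚ) →ₗ[ℚ] (Fin m → ℚ), (∀ v, B (act a 1 v) = act a' 1 (B v)) ∧
      ∀ g, height g = 0 → (rho a' L' (f g)).vec = B (rho a L g).vec := by
  obtain ⟨B, hB⟩ := exists_linearMap_extending (n := n) (V := Fin m → ℚ)
    (AddMonoidHom.mk' (fun v => (rho a' L' (f (Xv n _ L v))).vec) (fun v w => by
      rw [Xv_add, map_mul, map_mul, Aff.vec_mul, rho_exp, hf, height_Xv, act_zero]))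
  simp only [AddMonoidHom.mk'_apply] at hB
  obtain ⟨X, hX⟩ : ∃ X, X = rho a' L' (f (Tg n _ L)) := ⟨_, rfl⟩
  have hXe : X.exp = 1 := by rw [hX, rho_exp, hf, height_Tg]
  have hfX : ∀ v, rho a' L' (f (Xv n _ L v)) = ⟨B (ZtoQ n v), 0⟩ := fun v => by
    ext1
    · exact (hB v).symm
    · simp [hf]
  have hBa : ∀ v, B (act a 1 v) = act a' 1 (B v) := by
    have : B ∘ₗ act a 1 = act a' 1 ∘ₗ B := by
      refine linearMap_ext_of_lattice hL fun v hv => ?_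
      obtain ⟨w, hw⟩ := QImage_le_iff.1 hLA v hv
      have h := congrArg (fun g => (rho a' L' (f g)).vec) (Tg_mul_Xv hv hw)
      simp only [map_mul, ← hX, hfX, Aff.vec_mul, hXe, act_zero] at h
      rw [add_comm X.vec] at h
      have h := add_right_cancel h
      rw [hw, ← act_one] at h
      exact h.symm
    exact fun v => LinearMap.congr_fun this v
  have hBj : ∀ j v, B (act a j v) = act a' j (B v) := by
    intro j
    induction j with
    | zero => simp
    | succ j ih => intro v; rw [← act_act, ih, hBa, act_act]
    | pred j ih =>
      intro v
      apply act_injective a' 1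
      rw [← hBa, act_act, act_act, add_sub_cancel, ih]
  have hXj : ∀ j : ℤ, (X ^ j).exp = j := fun j => by rw [hX, ← map_zpow, rho_exp, ← map_zpow]; simp [hf]
  have key : ∀ g, rho a' L' (f g) = ⟨B (rho a L g).vec, 0⟩ * X ^ height g := by
    intro g
    induction g using induction_mul with
    | hX v => simp [hfX]
    | hT =>
      rw [← hX, height_Tg, zpow_one]
      ext <;> simp
    | hT' =>
      rw [map_inv, map_inv, ← hX, height_inv, height_Tg, _root_.zpow_neg, zpow_one]
      ext <;> simp
    | hmul g h hg hh =>
      have hc : X ^ height g * ⟨B (rho a L h).vec, 0⟩ =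
          ⟨act a' (height g) (B (rho a L h).vec), 0⟩ * X ^ height g := by
        ext1
        · simp [hXj, add_comm]
        · simp
      rw [map_mul, map_mul, hg, hh, mul_assoc, ← mul_assoc (X ^ _), hc, height_mul,
        _root_.zpow_add, ← mul_assoc, ← mul_assoc, ← mul_assoc]
      congr 2
      ext1
      · simp [hBj]
      · simp
  refine ⟨B, hBa, fun g hg => ?_⟩
  rw [key, hg]
  simp

lemma exists_linearEquiv_of_height (hL : L.FiniteIndex) (hL' : L'.FiniteIndex)
    (hLA : QImage (a : Matrix (Fin n) (Fin n) ℚ) L ≤ (ZtoQ n).range)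
    (hLA' : QImage (a' : Matrix (Fin m) (Fin m) ℚ) L' ≤ (ZtoQ m).range)
    (f : LM n (a : Matrix (Fin n) (Fin n) ℚ) L ≃* LM m (a' : Matrix (Fin m) (Fin m) ℚ) L')
    (hf : ∀ g, height (f g) = height g) :
    ∃ B : (Fin n → ℚ) ≃ₗ[ℚ] (Fin m → ℚ), (∀ v, B (act a 1 v) = act a' 1 (B v)) ∧
      ∀ g, height g = 0 → (rho a' L' (f g)).vec = B (rho a L g).vec := by
  obtain ⟨B, hB, hBf⟩ := exists_linear_of_height hL hLA f.toMonoidHom hf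
  have hf' : ∀ g, height (f.symm g) = height g := fun g => by
    rw [← hf, f.apply_symm_apply]
  obtain ⟨B', hB', hBf'⟩ := exists_linear_of_height hL' hLA' f.symm.toMonoidHom hf'
  simp only [MulEquiv.toMonoidHom_eq_coe, MonoidHom.coe_coe] at hBf hBf'
  refine ⟨LinearEquiv.ofLinearMap B B' ?_ ?_, hB, hBf⟩
  · refine linearMap_ext_of_lattice hL' fun v _ => ?_
    have h1 := hBf' (Xv m _ L' v) (height_Xv v)
    have h2 := hBf (f.symm (Xv m _ L' v)) (by rw [hf', height_Xv])
    rw [f.apply_symm_apply, h1, rho_Xv] at h2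
    exact h2.symm
  · refine linearMap_ext_of_lattice hL fun v _ => ?_
    have h1 := hBf (Xv n _ L v) (height_Xv v)
    have h2 := hBf' (f (Xv n _ L v)) (by rw [hf, height_Xv])
    rw [f.symm_apply_apply, h1, rho_Xv] at h2
    exact h2.symm

end Comparison
end LM

namespace LM

section NonAscending

variable {n m : ℕ} {a : GL (Fin n) ℚ} {a' : GL (Fin m) ℚ} {L : AddSubgroup (Fin n → ℤ)}
  {L' : AddSubgroup (Fin m → ℤ)}

lemma exists_conj_map_base (hL : L.FiniteIndex)
    (hLA : QImage (a : Matrix (Fin n) (Fin n) ℚ) L ≤ (ZtoQ n).range)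
    (hLA' : QImage (a' : Matrix (Fin m) (Fin m) ℚ) L' ≤ (ZtoQ m).range)
    (hL't : L' ≠ ⊤) (hAL't : ALsub (a' : Matrix (Fin m) (Fin m) ℚ) L' ≠ ⊤)
    (f : LM n (a : Matrix (Fin n) (Fin n) ℚ) L ≃* LM m (a' : Matrix (Fin m) (Fin m) ℚ) L') :
    ∃ x, ∀ v, ∃ w, x * f (Xv n _ L v) * x⁻¹ = Xv m _ L' w := by
  obtain ⟨x, hx⟩ := exists_conj_mem_base hLA' hL't hAL't (f.toMonoidHom.comp (base _ L)) (by
    intro v x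
    obtain ⟨k, hk, w, hw⟩ := exists_conj_nsmul hLA hL (f.symm x) v.toAdd
    refine ⟨k, hk, ?_⟩
    have h := ((Xv_commute w v.toAdd).map f)
    rw [← hw, map_mul, map_mul, map_inv, f.apply_symm_apply, Xv_nsmul, map_pow] at h
    exact h)
  exact ⟨x, fun v => hx (.ofAdd v)⟩

lemma exists_equiv_preserving_base (hL : L.FiniteIndex) (hL' : L'.FiniteIndex)
    (hLA : QImage (a : Matrix (Fin n) (Fin n) ℚ) L ≤ (ZtoQ n).range)
    (hLA' : QImage (a' : Matrix (Fin m) (Fin m) ℚ) L' ≤ (ZtoQ m).range)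
    (hLt : L ≠ ⊤) (hALt : ALsub (a : Matrix (Fin n) (Fin n) ℚ) L ≠ ⊤)
    (hL't : L' ≠ ⊤) (hAL't : ALsub (a' : Matrix (Fin m) (Fin m) ℚ) L' ≠ ⊤)
    (f : LM n (a : Matrix (Fin n) (Fin n) ℚ) L ≃* LM m (a' : Matrix (Fin m) (Fin m) ℚ) L') :
    ∃ (g : LM n (a : Matrix (Fin n) (Fin n) ℚ) L ≃* LM m (a' : Matrix (Fin m) (Fin m) ℚ) L')
      (b : (Fin n → ℤ) ≃+ (Fin m → ℤ)), ∀ v, g (Xv n _ L v) = Xv m _ L' (b v) := by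
  obtain ⟨x, hx⟩ := exists_conj_map_base hL hLA hLA' hL't hAL't f
  obtain ⟨y, hy⟩ := exists_conj_map_base hL' hLA' hLA hLt hALt f.symm
  have hxy : ∀ w, ∃ v, (x * f y) * Xv m _ L' w * (x * f y)⁻¹ = x * f (Xv n _ L v) * x⁻¹ := by
    intro w
    obtain ⟨v, hv⟩ := hy w
    refine ⟨v, ?_⟩
    rw [← hv]
    simp [mul_assoc]
  obtain ⟨u, hu⟩ := mem_base_of_conj_le hLA' hL't hAL't (x * f y)⁻¹ (by
    intro w
    obtain ⟨v, hv⟩ := hxy w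
    obtain ⟨w', hw'⟩ := hx v
    exact ⟨w', by rw [← hw', ← hv, inv_inv]⟩)
  have hsurj : ∀ w, ∃ v, x * f (Xv n _ L v) * x⁻¹ = Xv m _ L' w := by
    intro w
    obtain ⟨v, hv⟩ := hxy w
    refine ⟨v, ?_⟩
    rw [← hv, ← inv_inv (x * f y), hu, inv_inv, mul_assoc, (Xv_commute w u).eq, inv_mul_cancel_left]
  choose b hb using hx
  have hbadd : ∀ v w, b (v + w) = b v + b w := fun v w => by
    apply Xv_injective (a := a') (L := L')
    rw [← hb, Xv_add, Xv_add, ← hb, ← hb, map_mul]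
    simp [mul_assoc]
  have hbij : Function.Bijective (AddMonoidHom.mk' b hbadd) := by
    constructor
    · intro v w h
      have h : b v = b w := h
      apply Xv_injective (a := a) (L := L)
      apply f.injective
      have := hb v
      rw [h, ← hb w] at this
      simpa using this
    · intro w
      obtain ⟨v, hv⟩ := hsurj w
      exact ⟨v, Xv_injective (a := a') (L := L') (by rw [← hv, hb]; rfl)⟩
  exact ⟨f.trans (MulAut.conj x), AddEquiv.ofBijective _ hbij, fun v => hb v⟩

lemma map_mem_of_preserving_base (hLA' : QImage (a' : Matrix (Fin m) (Fin m) ℚ) L' ≤ (ZtoQ m).range)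
    (hLA : QImage (a : Matrix (Fin n) (Fin n) ℚ) L ≤ (ZtoQ n).range)
    {f : LM n (a : Matrix (Fin n) (Fin n) ℚ) L ≃* LM m (a' : Matrix (Fin m) (Fin m) ℚ) L'}
    {b : (Fin n → ℤ) ≃+ (Fin m → ℤ)} (hfb : ∀ v, f (Xv n _ L v) = Xv m _ L' (b v))
    (hf : ∀ g, height (f g) = height g) {v : Fin n → ℤ} (hv : v ∈ L) : b v ∈ L' := by
  obtain ⟨w, hw⟩ := QImage_le_iff.1 hLA v hv
  refine mem_of_height_eq_neg_one hLA' (g := f (Tg n _ L)⁻¹) (by rw [hf]; simp) (v' := b w) ?_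
  rw [← hfb, ← hfb, ← map_mul, ← map_mul]
  congr 1
  rw [mul_inv_eq_iff_eq_mul, mul_assoc, eq_inv_mul_iff_mul_eq]
  exact Tg_mul_Xv hv hw

lemma data_of_preserving_base (hL : L.FiniteIndex)
    (hLA : QImage (a : Matrix (Fin n) (Fin n) ℚ) L ≤ (ZtoQ n).range)
    (hLA' : QImage (a' : Matrix (Fin m) (Fin m) ℚ) L' ≤ (ZtoQ m).range)
    (f : LM n (a : Matrix (Fin n) (Fin n) ℚ) L ≃* LM m (a' : Matrix (Fin m) (Fin m) ℚ) L')
    (b : (Fin n → ℤ) ≃+ (Fin m → ℤ)) (hfb : ∀ v, f (Xv n _ L v) = Xv m _ L' (b v))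
    (hf : ∀ g, height (f g) = height g) :
    L' = L.map b.toAddMonoidHom ∧ ∃ B : (Fin n → ℚ) →ₗ[ℚ] (Fin m → ℚ),
      (∀ v, B (act a 1 v) = act a' 1 (B v)) ∧ ∀ v, B (ZtoQ n v) = ZtoQ m (b v) := by
  constructor
  · ext w
    rw [AddSubgroup.mem_map]
    constructor
    · intro hw
      refine ⟨b.symm w, ?_, by simp⟩
      exact map_mem_of_preserving_base (f := f.symm) (b := b.symm) hLA hLA'
        (fun v => by rw [f.symm_apply_eq, hfb, b.apply_symm_apply])
        (fun g => by rw [← hf, f.apply_symm_apply]) hw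
    · rintro ⟨v, hv, rfl⟩
      exact map_mem_of_preserving_base hLA' hLA hfb hf hv
  · obtain ⟨B, hB, hBf⟩ := exists_linear_of_height hL hLA f.toMonoidHom hf
    refine ⟨B, hB, fun v => ?_⟩
    have := hBf (Xv n _ L v) (height_Xv v)
    rw [rho_Xv] at this
    rw [← this]
    simp [hfb]

end NonAscending
end LM

section InverseData

variable {n : ℕ} {a : GL (Fin n) ℚ} {L : AddSubgroup (Fin n → ℤ)}

lemma mem_ALsub_inv {v : Fin n → ℤ} :
    v ∈ ALsub ((a⁻¹ : GL (Fin n) ℚ) : Matrix (Fin n) (Fin n) ℚ) (ALsub a L) ↔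
      v ∈ L ∧ ∃ w, ZtoQ n w = act a 1 (ZtoQ n v) := by
  rw [mem_ALsub]
  constructor
  · rintro ⟨w, hw, h⟩
    obtain ⟨u, hu, hu'⟩ := mem_ALsub.1 hw
    rw [← act_one] at hu'
    rw [← hu', ← act_one, act_inv, act_act, neg_add_cancel, act_zero] at h
    obtain rfl := ZtoQ_injective n h
    exact ⟨hu, w, hu'.symm⟩
  · rintro ⟨hv, w, hw⟩
    refine ⟨w, mem_ALsub.2 ⟨v, hv, by rw [hw, act_one]⟩, ?_⟩
    rw [hw, ← act_one, act_inv, act_act, neg_add_cancel, act_zero]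

lemma ALsub_inv (hLA : QImage (a : Matrix (Fin n) (Fin n) ℚ) L ≤ (ZtoQ n).range) :
    ALsub ((a⁻¹ : GL (Fin n) ℚ) : Matrix (Fin n) (Fin n) ℚ) (ALsub a L) = L := by
  ext v
  rw [mem_ALsub_inv, and_iff_left_iff_imp, act_one]
  exact fun hv => QImage_le_iff.1 hLA v hv

lemma QImage_inv_le :
    QImage ((a⁻¹ : GL (Fin n) ℚ) : Matrix (Fin n) (Fin n) ℚ) (ALsub a L) ≤ (ZtoQ n).range := by
  rw [QImage_le_iff]
  intro w hw
  obtain ⟨v, -, h⟩ := mem_ALsub.1 hw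
  refine ⟨v, ?_⟩
  rw [← h, ← act_one, ← act_one, act_inv, act_act, neg_add_cancel, act_zero]

lemma finiteIndex_of_forall_exists_nsmul {M : AddSubgroup (Fin n → ℤ)}
    (h : ∀ v, ∃ k : ℕ, k ≠ 0 ∧ k • v ∈ M) : M.FiniteIndex := by
  have : Module.Finite ℤ ((Fin n → ℤ) ⧸ M) :=
    Module.Finite.of_surjective (QuotientAddGroup.mk' M).toIntLinearMap
      (QuotientAddGroup.mk'_surjective M)
  have : Finite ((Fin n → ℤ) ⧸ M) := by
    refine Module.finite_of_fg_torsion _ fun x => ?_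
    obtain ⟨v, rfl⟩ := QuotientAddGroup.mk_surjective x
    obtain ⟨k, hk, hkv⟩ := h v
    refine ⟨⟨k, mem_nonZeroDivisors_of_ne_zero (by exact_mod_cast hk)⟩, ?_⟩
    change (k : ℤ) • (v : (Fin n → ℤ) ⧸ M) = 0
    rw [natCast_zsmul, ← QuotientAddGroup.mk_nsmul]
    exact (QuotientAddGroup.eq_zero_iff _).2 hkv
  exact AddSubgroup.finiteIndex_of_finite_quotient

lemma finiteIndex_ALsub (hL : L.FiniteIndex) :
    (ALsub (a : Matrix (Fin n) (Fin n) ℚ) L).FiniteIndex := by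
  refine finiteIndex_of_forall_exists_nsmul fun w => ?_
  obtain ⟨k, hk, v, hv, h⟩ := LM.exists_nsmul_eq_intCast hL (act a (-1) (ZtoQ n w))
  refine ⟨k, hk, mem_ALsub.2 ⟨v, hv, ?_⟩⟩
  rw [h, ← act_one, map_nsmul, map_nsmul, act_act, add_neg_cancel, act_zero]

lemma mem_unionSet {x : Fin n → ℚ} :
    x ∈ unionSet (a : Matrix (Fin n) (Fin n) ℚ) ↔ ∃ (j : ℤ) (v : Fin n → ℤ),
      act a j (ZtoQ n v) = x := by
  simp [unionSet, act_apply, Matrix.coe_units_zpow]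

lemma unionSet_inv :
    unionSet ((a⁻¹ : GL (Fin n) ℚ) : Matrix (Fin n) (Fin n) ℚ) =
      unionSet (a : Matrix (Fin n) (Fin n) ℚ) := by
  ext x
  rw [mem_unionSet, mem_unionSet]
  constructor
  · rintro ⟨j, v, h⟩
    exact ⟨-j, v, by rw [← h, act_inv]⟩
  · rintro ⟨j, v, h⟩
    exact ⟨-j, v, by rw [← h, act_inv, neg_neg]⟩

end InverseData

namespace LM

section Ascending

lemma exists_normalForm_aux {n : ℕ} {A : Matrix (Fin n) (Fin n) ℚ} {L : AddSubgroup (Fin n → ℤ)}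
    (s : LM n A L) (hs : Tg n A L = s ∨ Tg n A L = s⁻¹)
    (h : ∀ v, ∃ w, s * Xv n A L v = Xv n A L w * s) (g : LM n A L) :
    ∃ (k l : ℕ) (v : Fin n → ℤ), g = (s ^ k)⁻¹ * Xv n A L v * s ^ l := by
  have hpow : ∀ (k : ℕ) v, ∃ w, s ^ k * Xv n A L v = Xv n A L w * s ^ k := by
    intro k
    induction k with
    | zero => exact fun v => ⟨v, by simp⟩
    | succ k ih =>
      intro v
      obtain ⟨w, hw⟩ := ih v
      obtain ⟨w', hw'⟩ := h w
      exact ⟨w', by rw [pow_succ', mul_assoc, hw, ← mul_assoc, hw', mul_assoc]⟩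
  have hstep : ∀ (k l : ℕ) v, ∃ (k' l' : ℕ) (v' : Fin n → ℤ),
      s * ((s ^ k)⁻¹ * Xv n A L v * s ^ l) = (s ^ k')⁻¹ * Xv n A L v' * s ^ l' := by
    intro k l v
    cases k with
    | zero =>
      obtain ⟨w, hw⟩ := h v
      exact ⟨0, l + 1, w, by
        simp only [pow_zero, inv_one, one_mul]; rw [← mul_assoc, hw, pow_succ', mul_assoc]⟩
    | succ k => exact ⟨k, l, v, by simp [pow_succ, mul_assoc]⟩
  have hstep' : ∀ (k l : ℕ) v, ∃ (k' l' : ℕ) (v' : Fin n → ℤ),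
      s⁻¹ * ((s ^ k)⁻¹ * Xv n A L v * s ^ l) = (s ^ k')⁻¹ * Xv n A L v' * s ^ l' :=
    fun k l v => ⟨k + 1, l, v, by simp [pow_succ, mul_assoc]⟩
  have key : ∀ g : LM n A L, ∀ (k l : ℕ) v, ∃ (k' l' : ℕ) (v' : Fin n → ℤ),
      g * ((s ^ k)⁻¹ * Xv n A L v * s ^ l) = (s ^ k')⁻¹ * Xv n A L v' * s ^ l' := by
    intro g
    induction g using induction_mul with
    | hX u =>
      intro k l v
      obtain ⟨w, hw⟩ := hpow k u
      refine ⟨k, l, w + v, ?_⟩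
      have h1 : Xv n A L u * (s ^ k)⁻¹ = (s ^ k)⁻¹ * Xv n A L w := by
        rw [mul_inv_eq_iff_eq_mul, mul_assoc, ← hw, inv_mul_cancel_left]
      rw [← mul_assoc, ← mul_assoc, h1, Xv_add]
      simp only [mul_assoc]
    | hT => rcases hs with hs | hs <;> rw [hs] <;> assumption
    | hT' => rcases hs with hs | hs <;> rw [hs] <;> simpa
    | hmul g h hg hh =>
      intro k l v
      obtain ⟨k', l', v', h1⟩ := hh k l v
      obtain ⟨k'', l'', v'', h2⟩ := hg k' l' v'
      exact ⟨k'', l'', v'', by rw [mul_assoc, h1, h2]⟩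
  obtain ⟨k, l, v, h1⟩ := key g 0 0 0
  exact ⟨k, l, v, by simpa using h1⟩

variable {n : ℕ} {a : GL (Fin n) ℚ} {L : AddSubgroup (Fin n → ℤ)}

lemma exists_normalForm (hLA : QImage (a : Matrix (Fin n) (Fin n) ℚ) L ≤ (ZtoQ n).range)
    (hasc : L = ⊤ ∨ ALsub (a : Matrix (Fin n) (Fin n) ℚ) L = ⊤)
    (g : LM n (a : Matrix (Fin n) (Fin n) ℚ) L) :
    ∃ (i j : ℤ) (v : Fin n → ℤ), g = Tg n _ L ^ i * Xv n _ L v * Tg n _ L ^ j := by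
  rcases hasc with hL | hL
  · obtain ⟨k, l, v, h⟩ := exists_normalForm_aux (Tg n _ L) (.inl rfl) (fun v => by
      have hv : v ∈ L := hL ▸ AddSubgroup.mem_top v
      obtain ⟨w, hw⟩ := QImage_le_iff.1 hLA v hv
      exact ⟨w, Tg_mul_Xv hv hw⟩) g
    exact ⟨-k, l, v, by simpa using h⟩
  · obtain ⟨k, l, v, h⟩ := exists_normalForm_aux (Tg n _ L)⁻¹ (.inr (inv_inv _).symm) (fun w => by
      have hw : w ∈ ALsub (a : Matrix (Fin n) (Fin n) ℚ) L := hL ▸ AddSubgroup.mem_top w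
      obtain ⟨v, hv, hvw⟩ := mem_ALsub.1 hw
      refine ⟨v, ?_⟩
      rw [inv_mul_eq_iff_eq_mul, ← mul_assoc, eq_mul_inv_iff_mul_eq]
      exact (Tg_mul_Xv hv hvw.symm).symm) g
    exact ⟨k, -l, v, by simpa using h⟩

lemma rho_injective (hLA : QImage (a : Matrix (Fin n) (Fin n) ℚ) L ≤ (ZtoQ n).range)
    (hasc : L = ⊤ ∨ ALsub (a : Matrix (Fin n) (Fin n) ℚ) L = ⊤) :
    Function.Injective (rho a L) := by
  rw [injective_iff_map_eq_one]
  intro g hg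
  obtain ⟨i, j, v, rfl⟩ := exists_normalForm hLA hasc g
  have h1 := congrArg Aff.exp hg
  have h2 := congrArg Aff.vec hg
  simp only [map_mul, rho_Tg_zpow, rho_Xv, Aff.vec_mul, Aff.exp_mul, Aff.vec_one, Aff.exp_one,
    map_zero, zero_add, add_zero] at h1 h2
  have h3 : v = 0 := ZtoQ_injective n (act_injective a i (by simpa using h2))
  rw [h3, Xv_zero, mul_one, ← _root_.zpow_add, h1, zpow_zero]

lemma exists_height_zero {x : Fin n → ℚ} (hx : x ∈ unionSet (a : Matrix (Fin n) (Fin n) ℚ)) :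
    ∃ g, height g = 0 ∧ (rho a L g).vec = x := by
  obtain ⟨j, v, rfl⟩ := mem_unionSet.1 hx
  refine ⟨Tg n _ L ^ j * Xv n _ L v * (Tg n _ L ^ j)⁻¹, by simp, ?_⟩
  simp only [map_mul, map_inv, rho_Tg_zpow, rho_Xv]
  simp

lemma vec_mem_unionSet (hLA : QImage (a : Matrix (Fin n) (Fin n) ℚ) L ≤ (ZtoQ n).range)
    (hasc : L = ⊤ ∨ ALsub (a : Matrix (Fin n) (Fin n) ℚ) L = ⊤)
    (g : LM n (a : Matrix (Fin n) (Fin n) ℚ) L) :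
    (rho a L g).vec ∈ unionSet (a : Matrix (Fin n) (Fin n) ℚ) := by
  obtain ⟨i, j, v, rfl⟩ := exists_normalForm hLA hasc g
  refine mem_unionSet.2 ⟨i, v, ?_⟩
  simp only [map_mul, rho_Tg_zpow, rho_Xv]
  simp

lemma mem_range_rho (hLA : QImage (a : Matrix (Fin n) (Fin n) ℚ) L ≤ (ZtoQ n).range)
    (hasc : L = ⊤ ∨ ALsub (a : Matrix (Fin n) (Fin n) ℚ) L = ⊤) {x : Aff a} :
    x ∈ (rho a L).range ↔ x.vec ∈ unionSet (a : Matrix (Fin n) (Fin n) ℚ) := by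
  constructor
  · rintro ⟨g, rfl⟩
    exact vec_mem_unionSet hLA hasc g
  · intro hx
    obtain ⟨g, hg, hgx⟩ := exists_height_zero (L := L) hx
    refine ⟨g * Tg n _ L ^ x.exp, ?_⟩
    rw [map_mul, rho_Tg_zpow]
    ext1
    · simp [hgx]
    · simp [hg]

/-- An ascending Leary–Minasyan group is metabelian. -/
lemma commute_of_height_eq_zero (hLA : QImage (a : Matrix (Fin n) (Fin n) ℚ) L ≤ (ZtoQ n).range)
    (hasc : L = ⊤ ∨ ALsub (a : Matrix (Fin n) (Fin n) ℚ) L = ⊤)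
    {g h : LM n (a : Matrix (Fin n) (Fin n) ℚ) L} (hg : height g = 0) (hh : height h = 0) :
    Commute g h := by
  apply rho_injective hLA hasc
  rw [map_mul, map_mul]
  ext1
  · simp [hg, hh, add_comm]
  · simp [add_comm]

/-- Rationally conjugate ascending data with matching modules give isomorphic groups. -/
lemma nonempty_equiv_of_conj {a' : GL (Fin n) ℚ} {L' : AddSubgroup (Fin n → ℤ)}
    (hLA : QImage (a : Matrix (Fin n) (Fin n) ℚ) L ≤ (ZtoQ n).range)
    (hasc : L = ⊤ ∨ ALsub (a : Matrix (Fin n) (Fin n) ℚ) L = ⊤)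
    (hLA' : QImage (a' : Matrix (Fin n) (Fin n) ℚ) L' ≤ (ZtoQ n).range)
    (hasc' : L' = ⊤ ∨ ALsub (a' : Matrix (Fin n) (Fin n) ℚ) L' = ⊤)
    (B : (Fin n → ℚ) ≃ₗ[ℚ] (Fin n → ℚ)) (hB : ∀ j v, B (act a j v) = act a' j (B v))
    (hU : ∀ x, B x ∈ unionSet (a' : Matrix (Fin n) (Fin n) ℚ) ↔
      x ∈ unionSet (a : Matrix (Fin n) (Fin n) ℚ)) :
    Nonempty (LM n (a : Matrix (Fin n) (Fin n) ℚ) L ≃*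
      LM n (a' : Matrix (Fin n) (Fin n) ℚ) L') := by
  let σ : Aff a →* Aff a' := MonoidHom.mk' (fun x => ⟨B x.vec, x.exp⟩) (fun x y => by
    ext1
    · simp [hB]
    · simp)
  have hσ : Function.Injective (σ.comp (rho a L)) := by
    refine Function.Injective.comp (g := σ) (fun x y h => ?_) (rho_injective hLA hasc)
    ext1
    · exact B.injective (congrArg Aff.vec h)
    · have h2 : (σ x).exp = (σ y).exp := congrArg Aff.exp h
      exact h2
  have hrange : (σ.comp (rho a L)).range = (rho a' L').range := by
    ext x
    rw [mem_range_rho hLA' hasc']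
    constructor
    · rintro ⟨g, rfl⟩
      exact (hU _).2 (vec_mem_unionSet hLA hasc g)
    · intro hx
      rw [← B.apply_symm_apply x.vec, hU] at hx
      obtain ⟨g, hg⟩ := (mem_range_rho hLA hasc (x := ⟨B.symm x.vec, x.exp⟩)).2 hx
      refine ⟨g, ?_⟩
      rw [MonoidHom.comp_apply, hg]
      ext1
      · exact B.apply_symm_apply _
      · rfl
  exact ⟨((MonoidHom.ofInjective hσ).trans (MulEquiv.subgroupCongr hrange)).trans
    (MonoidHom.ofInjective (rho_injective hLA' hasc')).symm⟩

lemma act_eq_of_hom_int (χ : LM n (a : Matrix (Fin n) (Fin n) ℚ) L →* Multiplicative ℤ)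
    (hχ : ∀ g h, χ g = 1 → χ h = 1 → Commute g h) (v₀ : Fin n → ℤ) {k : Fin n → ℤ}
    (hk : χ (Xv n _ L k) = 1) :
    act a (-(χ (Xv n _ L v₀)).toAdd) (ZtoQ n k) = ZtoQ n k := by
  have hm : χ (Xv n _ L v₀ ^ (χ (Tg n _ L)).toAdd *
      Tg n _ L ^ (-(χ (Xv n _ L v₀)).toAdd)) = 1 := by
    apply Multiplicative.toAdd.injective
    rw [map_mul, map_zpow, map_zpow, toAdd_mul, toAdd_zpow, toAdd_zpow]
    simp [mul_comm]
  have := congrArg (fun g => (rho a L g).vec) (hχ _ _ hm hk).eq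
  rw [← Xv_zsmul] at this
  simp only [map_mul, rho_Tg_zpow, rho_Xv] at this
  simp only [Aff.vec_mul, Aff.exp_mul, zero_add, act_zero, map_zero, add_zero] at this
  rw [add_comm] at this
  exact add_right_cancel this

lemma exists_inverse_integral (hLA : QImage (a : Matrix (Fin n) (Fin n) ℚ) L ≤ (ZtoQ n).range)
    (hL : L = ⊤) (χ : LM n (a : Matrix (Fin n) (Fin n) ℚ) L →* Multiplicative ℤ)
    (hχ : ∀ g h, χ g = 1 → χ h = 1 → Commute g h) (hX : ∃ v, χ (Xv n _ L v) ≠ 1)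
    (v : Fin n → ℤ) : ∃ w, ZtoQ n w = act a (-1) (ZtoQ n v) := by
  obtain ⟨v₀, hv₀⟩ := hX
  obtain ⟨ℓ, hℓ⟩ : ∃ ℓ, ℓ = (χ (Xv n _ L v₀)).toAdd := ⟨_, rfl⟩
  have hℓ0 : ℓ ≠ 0 := fun h => hv₀ (Multiplicative.toAdd.injective (by rw [← hℓ, h]; rfl))
  have hker : ∀ k, χ (Xv n _ L k) = 1 → act a (-ℓ) (ZtoQ n k) = ZtoQ n k :=
    fun k hk => hℓ ▸ act_eq_of_hom_int χ hχ v₀ hk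
  have hker' : ∀ k, χ (Xv n _ L k) = 1 → act a (ℓ.natAbs : ℤ) (ZtoQ n k) = ZtoQ n k := by
    intro k hk
    rcases le_total 0 ℓ with h | h
    · have h1 := congrArg (act a ℓ) (hker k hk)
      rw [act_act, add_neg_cancel, act_zero] at h1
      rw [Int.natAbs_of_nonneg h, ← h1]
    · rw [Int.ofNat_natAbs_of_nonpos h, hker k hk]
  have hpow : ∀ j : ℕ, ∃ w, ZtoQ n w = act a j (ZtoQ n v) ∧ χ (Xv n _ L w) = χ (Xv n _ L v) := by
    intro j
    induction j with
    | zero => exact ⟨v, by simp, rfl⟩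
    | succ j ih =>
      obtain ⟨w, hw, hwχ⟩ := ih
      have hwL : w ∈ L := hL ▸ AddSubgroup.mem_top w
      obtain ⟨u, hu⟩ := QImage_le_iff.1 hLA w hwL
      refine ⟨u, ?_, ?_⟩
      · rw [hu, ← act_one, hw, act_act, add_comm]
        push_cast
        rfl
      · have := congrArg χ (Tg_mul_Xv hwL hu)
        rw [map_mul, map_mul, mul_comm] at this
        rw [← hwχ, mul_right_cancel this]
  obtain ⟨d, hd⟩ : ∃ d, ℓ.natAbs = d + 1 :=
    ⟨ℓ.natAbs - 1, by have := Int.natAbs_pos.2 hℓ0; omega⟩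
  obtain ⟨w₁, hw₁, -⟩ := hpow d
  obtain ⟨w₂, hw₂, -⟩ := hpow (d + (d + 1))
  obtain ⟨w₃, hw₃, hw₃χ⟩ := hpow (d + 1)
  have h := hker' (w₃ - v) (by rw [Xv_sub, map_mul, map_inv, hw₃χ, mul_inv_cancel])
  rw [map_sub, hw₃, map_sub, act_act, hd] at h
  refine ⟨(2 : ℤ) • w₁ - w₂, ?_⟩
  have h' := congrArg (act a (-1)) h
  rw [map_sub, map_sub, act_act, act_act] at h'
  have e1 : (-1 : ℤ) + (((d + 1 : ℕ) : ℤ) + ((d + 1 : ℕ) : ℤ)) = ((d + (d + 1) : ℕ) : ℤ) := by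
    push_cast; ring
  have e2 : (-1 : ℤ) + ((d + 1 : ℕ) : ℤ) = (d : ℤ) := by push_cast; ring
  rw [e1, e2] at h'
  rw [map_sub, map_zsmul, hw₁, hw₂, two_zsmul]
  linear_combination -h'

lemma eq_top_of_hom_int (hLA : QImage (a : Matrix (Fin n) (Fin n) ℚ) L ≤ (ZtoQ n).range)
    (hasc : L = ⊤ ∨ ALsub (a : Matrix (Fin n) (Fin n) ℚ) L = ⊤)
    (χ : LM n (a : Matrix (Fin n) (Fin n) ℚ) L →* Multiplicative ℤ)
    (hχ : ∀ g h, χ g = 1 → χ h = 1 → Commute g h) (hX : ∃ v, χ (Xv n _ L v) ≠ 1) :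
    L = ⊤ ∧ ALsub (a : Matrix (Fin n) (Fin n) ℚ) L = ⊤ := by
  rcases hasc with hL | hL
  · refine ⟨hL, (AddSubgroup.eq_top_iff' _).2 fun w => ?_⟩
    obtain ⟨v, hv⟩ := exists_inverse_integral hLA hL χ hχ hX w
    refine mem_ALsub.2 ⟨v, hL ▸ AddSubgroup.mem_top v, ?_⟩
    rw [hv, ← act_one, act_act, add_neg_cancel, act_zero]
  · refine ⟨(AddSubgroup.eq_top_iff' _).2 fun v => ?_, hL⟩
    obtain ⟨e, heX, -⟩ := nonempty_equiv_inv a L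
    obtain ⟨v₀, hv₀⟩ := hX
    obtain ⟨w, hw⟩ := exists_inverse_integral QImage_inv_le hL (χ.comp e.symm.toMonoidHom)
      (fun g h hg hh => by simpa using (hχ _ _ hg hh).map e)
      ⟨v₀, by
        have : e.symm (Xv n _ _ v₀) = Xv n _ L v₀ := by rw [e.symm_apply_eq, heX]
        simpa [this] using hv₀⟩ v
    rw [act_inv, neg_neg] at hw
    have hwL : w ∈ ALsub (a : Matrix (Fin n) (Fin n) ℚ) L := hL ▸ AddSubgroup.mem_top w
    obtain ⟨u, hu, h⟩ := mem_ALsub.1 hwL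
    rw [hw, ← act_one] at h
    rw [← ZtoQ_injective n (act_injective a 1 h)]
    exact hu

end Ascending
end LM

section Integral

variable {n : ℕ}

/-- An integral unimodular matrix, viewed over `ℚ`. -/
def toQ (M : GL (Fin n) ℤ) : GL (Fin n) ℚ := Matrix.GeneralLinearGroup.map (Int.castRingHom ℚ) M

lemma QMat_mulVec_ZtoQ {M : Matrix (Fin n) (Fin n) ℤ} (v : Fin n → ℤ) :
    QMat M *ᵥ ZtoQ n v = ZtoQ n (M *ᵥ v) := by
  ext i
  simp [QMat, Matrix.mulVec, dotProduct]

lemma act_toQ (M : GL (Fin n) ℤ) (j : ℤ) (v : Fin n → ℤ) :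
    act (toQ M) j (ZtoQ n v) = ZtoQ n (act M j v) := by
  rw [act_apply, toQ, ← map_zpow, act_apply]
  exact QMat_mulVec_ZtoQ v

lemma act_zpow {R : Type*} [CommRing R] (a : GL (Fin n) R) (i j : ℤ) (v : Fin n → R) :
    act (a ^ i) j v = act a (i * j) v := by
  rw [act_apply, act_apply, _root_.zpow_mul]

lemma matrix_ext_of_lattice {A B : Matrix (Fin n) (Fin n) ℚ}
    (h : ∀ v, A *ᵥ ZtoQ n v = B *ᵥ ZtoQ n v) : A = B := by
  refine Matrix.ext_of_mulVec_single fun i => ?_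
  have h1 : ZtoQ n (Pi.single i 1) = Pi.single i 1 := by
    ext j
    simp [Pi.single_apply]
  rw [← h1, h]

lemma exists_GL_of_linearEquiv {R : Type*} [CommRing R] (b : (Fin n → R) ≃ₗ[R] (Fin n → R)) :
    ∃ P : GL (Fin n) R, ∀ v, act P 1 v = b v := by
  refine ⟨⟨LinearMap.toMatrix' b.toLinearMap, LinearMap.toMatrix' b.symm.toLinearMap, ?_, ?_⟩, ?_⟩
  · rw [← LinearMap.toMatrix'_comp]
    simp
  · rw [← LinearMap.toMatrix'_comp]
    simp
  · intro v
    rw [act_one]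
    exact LinearMap.toMatrix'_mulVec _ _

/-- A rational matrix which preserves `ℤ^n` is integral and unimodular. -/
lemma exists_toQ_eq {a : GL (Fin n) ℚ}
    (hLA : QImage (a : Matrix (Fin n) (Fin n) ℚ) ⊤ ≤ (ZtoQ n).range)
    (hAL : ALsub (a : Matrix (Fin n) (Fin n) ℚ) ⊤ = ⊤) : ∃ M, toQ M = a := by
  have h1 : ∀ v, ∃ w, ZtoQ n w = act a 1 (ZtoQ n v) := fun v => by
    simpa using QImage_le_iff.1 hLA v trivial
  have h2 : ∀ v, ∃ w, ZtoQ n w = act a (-1) (ZtoQ n v) := fun v => by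
    obtain ⟨w, -, hw⟩ := mem_ALsub.1 (hAL ▸ AddSubgroup.mem_top v)
    exact ⟨w, by rw [← hw, ← act_one, act_act, neg_add_cancel, act_zero]⟩
  choose f hf using h1
  choose g hg using h2
  have hfg : ∀ v, f (g v) = v := fun v => ZtoQ_injective n (by
    rw [hf, hg, act_act, add_neg_cancel, act_zero])
  have hgf : ∀ v, g (f v) = v := fun v => ZtoQ_injective n (by
    rw [hg, hf, act_act, neg_add_cancel, act_zero])
  let F : (Fin n → ℤ) ≃+ (Fin n → ℤ) :=
    { toFun := f, invFun := g, left_inv := hgf, right_inv := hfg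
      map_add' := fun v w => ZtoQ_injective n (by simp only [hf, map_add]) }
  obtain ⟨M, hM⟩ := exists_GL_of_linearEquiv F.toIntLinearEquiv
  refine ⟨M, Units.ext (matrix_ext_of_lattice fun v => ?_)⟩
  rw [← act_one, ← act_one, act_toQ, hM, ← hf]
  rfl

lemma QImage_toQ_le (M : GL (Fin n) ℤ) (L : AddSubgroup (Fin n → ℤ)) :
    QImage (toQ M : Matrix (Fin n) (Fin n) ℚ) L ≤ (ZtoQ n).range :=
  QImage_le_iff.2 fun v _ => ⟨act M 1 v, by rw [← act_toQ, act_one]⟩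

end Integral

section Block

variable {k : ℕ}

lemma blockOne_mulVec (u : Fin k → ℤ) (C : Matrix (Fin k) (Fin k) ℤ) (v : Fin (k + 1) → ℤ) :
    blockOne u C *ᵥ v = Fin.cons (v 0) (v 0 • u + C *ᵥ Fin.tail v) := by
  funext i
  refine Fin.cases ?_ (fun i => ?_) i
  · simp [blockOne, Matrix.mulVec, dotProduct, Fin.sum_univ_succ]
  · simp [blockOne, Matrix.mulVec, dotProduct, Fin.sum_univ_succ, Fin.tail, mul_comm]

lemma det_blockOne (u : Fin k → ℤ) (C : Matrix (Fin k) (Fin k) ℤ) :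
    (blockOne u C).det = C.det := by
  rw [Matrix.det_succ_row_zero, Fin.sum_univ_succ, Finset.sum_eq_zero fun i _ => ?_]
  · simp [blockOne]
    rfl
  · simp [blockOne]

/-- The block matrix `[[1, 0ᵀ],[u, c]]` with `c` unimodular. -/
def blockGL (u : Fin k → ℤ) (c : GL (Fin k) ℤ) : GL (Fin (k + 1)) ℤ :=
  Matrix.GeneralLinearGroup.mk'' (blockOne u c) (by
    rw [det_blockOne]; exact Matrix.isUnits_det_units c)

lemma coe_blockGL (u : Fin k → ℤ) (c : GL (Fin k) ℤ) :
    (blockGL u c : Matrix (Fin (k + 1)) (Fin (k + 1)) ℤ) = blockOne u c := rfl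

lemma act_blockGL_one (u : Fin k → ℤ) (c : GL (Fin k) ℤ) (v : Fin (k + 1) → ℤ) :
    act (blockGL u c) 1 v = Fin.cons (v 0) (v 0 • u + act c 1 (Fin.tail v)) := by
  rw [act_one, coe_blockGL, blockOne_mulVec, act_one]

@[simp] lemma act_blockGL_apply_zero (u : Fin k → ℤ) (c : GL (Fin k) ℤ) (j : ℤ)
    (v : Fin (k + 1) → ℤ) : act (blockGL u c) j v 0 = v 0 := by
  have h : ∀ v, act (blockGL u c) 1 v 0 = v 0 := fun v => by rw [act_blockGL_one]; rfl
  induction j with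
  | zero => rw [act_zero]
  | succ j ih => rw [add_comm (j : ℤ), ← act_act, h, ih]
  | pred j ih => rw [← h (act _ _ v), act_act, add_sub_cancel, ih]

lemma act_blockGL_cons_zero (u : Fin k → ℤ) (c : GL (Fin k) ℤ) (j : ℤ) (x : Fin k → ℤ) :
    act (blockGL u c) j (Fin.cons 0 x : Fin (k + 1) → ℤ) = Fin.cons 0 (act c j x) := by
  have h : ∀ x, act (blockGL u c) 1 (Fin.cons 0 x : Fin (k + 1) → ℤ) = Fin.cons 0 (act c 1 x) :=
    fun x => by rw [act_blockGL_one]; simp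
  induction j with
  | zero => simp only [act_zero]
  | succ j ih => rw [add_comm (j : ℤ), ← act_act, ih, h, act_act]
  | pred j ih =>
    apply act_injective (blockGL u c) 1
    rw [h, act_act, act_act, add_sub_cancel, ih]

lemma exists_eq_blockGL (N : GL (Fin (k + 1)) ℤ) (hN : ∀ v, act N 1 v 0 = v 0) :
    ∃ u c, N = blockGL u c := by
  let C : Matrix (Fin k) (Fin k) ℤ := (N : Matrix (Fin (k + 1)) (Fin (k + 1)) ℤ).submatrix
    Fin.succ Fin.succ
  have h : (N : Matrix (Fin (k + 1)) (Fin (k + 1)) ℤ) = blockOne (fun i => N.1 i.succ 0) C := by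
    ext i j
    refine Fin.cases ?_ (fun i => Fin.cases rfl (fun j => rfl) j) i
    have := hN (Pi.single j 1)
    rw [act_one, Matrix.mulVec_single_one] at this
    refine this.trans ?_
    refine Fin.cases ?_ (fun j => ?_) j
    · simp [blockOne]
    · simp [blockOne]
  have hC : IsUnit C.det := by
    rw [← det_blockOne (fun i => N.1 i.succ 0), ← h]
    exact Matrix.isUnits_det_units N
  exact ⟨_, Matrix.GeneralLinearGroup.mk'' C hC, Units.ext h⟩

lemma exists_act_sub_self {R : Type*} [CommRing R] (c : GL (Fin k) R) (j : ℤ) (x : Fin k → R) :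
    ∃ y, act c j x - x = act c 1 y - y := by
  induction j with
  | zero => exact ⟨0, by simp⟩
  | succ j ih =>
    obtain ⟨y, hy⟩ := ih
    refine ⟨y + act c j x, ?_⟩
    rw [map_add, act_act, add_comm 1 (j : ℤ)]
    linear_combination hy
  | pred j ih =>
    obtain ⟨y, hy⟩ := ih
    refine ⟨y - act c (-j - 1) x, ?_⟩
    rw [map_sub, act_act, add_sub_cancel]
    linear_combination hy

lemma exists_tail_act_blockGL (u : Fin k → ℤ) (c : GL (Fin k) ℤ) (j : ℤ) (v : Fin (k + 1) → ℤ) :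
    ∃ y, Fin.tail (act (blockGL u c) j v) = (j * v 0) • u + Fin.tail v + (act c 1 y - y) := by
  have h : ∀ v : Fin (k + 1) → ℤ, Fin.tail (act (blockGL u c) 1 v) =
      v 0 • u + act c 1 (Fin.tail v) := fun v => by rw [act_blockGL_one, Fin.tail_cons]
  induction j with
  | zero => exact ⟨0, by simp⟩
  | succ j ih =>
    obtain ⟨y, hy⟩ := ih
    refine ⟨y + Fin.tail (act (blockGL u c) j v), ?_⟩
    rw [add_comm (j : ℤ) 1, ← act_act, h, act_blockGL_apply_zero, map_add, add_mul, add_smul,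
      one_mul]
    linear_combination hy
  | pred j ih =>
    obtain ⟨y, hy⟩ := ih
    refine ⟨y - Fin.tail (act (blockGL u c) (-j - 1) v), ?_⟩
    have h1 := h (act (blockGL u c) (-j - 1) v)
    rw [act_act, add_sub_cancel, hy, act_blockGL_apply_zero] at h1
    rw [map_sub, sub_mul, sub_smul, one_mul]
    linear_combination -h1

/-- The vector equation behind the change of the pair `(x, t)` in case of a finite order block. -/
lemma exists_block_solution (u : Fin k → ℤ) (c : GL (Fin k) ℤ) (w : Fin (k + 1) → ℤ) (δ τ ℓ : ℤ)
    (h1 : ℓ * w 0 + τ * δ = 1) (h2 : c ^ ℓ = 1) : ∃ y : Fin k → ℤ,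
    w + act (blockGL u c) δ (Fin.cons τ y) =
      Fin.cons 0 u + Fin.cons τ y + act (blockGL u c) (-ℓ) w := by
  obtain ⟨y₁, hy₁⟩ := exists_tail_act_blockGL u c δ (Fin.cons τ 0)
  obtain ⟨y₂, hy₂⟩ := exists_tail_act_blockGL u c (-ℓ) w
  have hc : c = (c ^ δ) ^ τ := by
    rw [← _root_.zpow_mul, mul_comm δ, eq_sub_of_add_eq' h1, _root_.zpow_sub, _root_.zpow_mul, h2]
    simp
  obtain ⟨y, hy⟩ := exists_act_sub_self (c ^ δ) τ (y₂ - y₁)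
  refine ⟨y, ?_⟩
  have h3 : (Fin.cons τ y : Fin (k + 1) → ℤ) = Fin.cons τ 0 + Fin.cons 0 y := by
    ext i; refine Fin.cases ?_ (fun i => ?_) i <;> simp
  have h4 : act (c ^ δ) τ (y₂ - y₁) = act c 1 (y₂ - y₁) := by
    rw [act_zpow, act_apply, _root_.zpow_mul, ← hc, act_one]
  rw [h4, act_zpow, mul_one, map_sub] at hy
  have h5 : ℓ * w 0 = 1 - τ * δ := by linear_combination h1
  rw [neg_mul, h5] at hy₂
  rw [Fin.tail_cons, Fin.cons_zero] at hy₁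
  rw [h3, map_add, act_blockGL_cons_zero]
  ext i
  refine Fin.cases ?_ (fun i => ?_) i
  · simp [add_comm]
  · have e1 := congrFun hy₁ i
    have e2 := congrFun hy₂ i
    have e3 := congrFun hy i
    simp only [Fin.tail, Pi.add_apply, Pi.sub_apply, Pi.smul_apply, smul_eq_mul, Pi.zero_apply,
      Fin.cons_succ] at e1 e2 e3 ⊢
    linear_combination e1 - e2 - e3

end Block

namespace LM

section Unimodular

variable {n : ℕ} {M : GL (Fin n) ℤ}

lemma Tg_mul_Xv_toQ (v : Fin n → ℤ) :
    Tg n (toQ M : Matrix (Fin n) (Fin n) ℚ) ⊤ * Xv n _ _ v = Xv n _ _ (act M 1 v) * Tg n _ _ :=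
  Tg_mul_Xv trivial (by rw [← act_toQ, act_one])

lemma Tg_zpow_mul_Xv_toQ (j : ℤ) (v : Fin n → ℤ) :
    Tg n (toQ M : Matrix (Fin n) (Fin n) ℚ) ⊤ ^ j * Xv n _ _ v =
      Xv n _ _ (act M j v) * Tg n _ _ ^ j := by
  apply rho_injective (QImage_toQ_le M ⊤) (.inl rfl)
  rw [map_mul, map_mul, rho_Tg_zpow, rho_Xv, rho_Xv]
  ext1
  · simp [act_toQ]
  · simp

lemma exists_eq_Xv_mul_Tg_zpow (g : LM n (toQ M : Matrix (Fin n) (Fin n) ℚ) ⊤) :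
    ∃ v, g = Xv n _ _ v * Tg n _ _ ^ height g := by
  obtain ⟨i, j, v, h⟩ := exists_normalForm (QImage_toQ_le M ⊤) (.inl rfl) g
  refine ⟨act M i v, ?_⟩
  have hg : height g = i + j := by rw [h]; simp
  rw [hg, h, Tg_zpow_mul_Xv_toQ, mul_assoc, _root_.zpow_add]

end Unimodular

section Block

variable {k : ℕ} (u : Fin k → ℤ) (c : GL (Fin k) ℤ)

/-- The group defined by the block matrix `[[1, 0ᵀ],[u, c]]`. -/
abbrev BlockLM : Type := LM (k + 1) (toQ (blockGL u c) : Matrix (Fin (k + 1)) (Fin (k + 1)) ℚ) ⊤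

/-- The homomorphism to `ℤ` given by the first coordinate of the base. -/
def firstHom : BlockLM u c →* Multiplicative ℤ :=
  lift (MonoidHom.mk' (fun v => .ofAdd (v.toAdd 0)) fun _ _ => rfl) 1 fun v _ w hw => by
    rw [← act_one, act_toQ] at hw
    rw [ZtoQ_injective _ hw, one_mul, mul_one, MonoidHom.mk'_apply, toAdd_ofAdd, toAdd_ofAdd, act_blockGL_apply_zero]

@[simp] lemma firstHom_Xv (v : Fin (k + 1) → ℤ) :
    firstHom u c (Xv (k + 1) _ _ v) = .ofAdd (v 0) := by
  simp [firstHom]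

@[simp] lemma firstHom_Tg : firstHom u c (Tg (k + 1) _ _) = 1 := by simp [firstHom]

lemma exists_eq_Xv_cons_zero {g : BlockLM u c} (h1 : height g = 0) (h2 : firstHom u c g = 1) : ∃ x, g = Xv (k + 1) _ _ (Fin.cons 0 x) := by
  obtain ⟨v, hv⟩ := exists_eq_Xv_mul_Tg_zpow g
  rw [h1, zpow_zero, mul_one] at hv
  rw [hv, firstHom_Xv, ofAdd_eq_one] at h2
  exact ⟨Fin.tail v, by rw [hv, ← h2, Fin.cons_self_tail]⟩

/-- A unimodular change of the pair `(x₁, t)` in a group with a finite order block. -/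
lemma exists_equiv_block_zpow (w : Fin (k + 1) → ℤ) (δ τ ℓ : ℤ)
    (h1 : ℓ * w 0 + τ * δ = 1) (h2 : c ^ ℓ = 1) :
    ∃ (F : BlockLM u (c ^ δ) ≃* BlockLM u c) (y : Fin k → ℤ),
      F (Tg (k + 1) _ _) = Xv (k + 1) _ _ w * Tg (k + 1) _ _ ^ δ ∧
      ∀ v, F (Xv (k + 1) _ _ v) = Xv (k + 1) _ _ (Fin.cons 0 (Fin.tail v)) *
        (Xv (k + 1) _ _ (Fin.cons τ y) * Tg (k + 1) _ _ ^ (-ℓ)) ^ v 0 := by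
  obtain ⟨y, hy⟩ := exists_block_solution u c w δ τ ℓ h1 h2
  obtain ⟨ι, hι⟩ : ∃ ι : (Fin k → ℤ) → BlockLM u c,
      ∀ x, ι x = Xv (k + 1) _ _ (Fin.cons 0 x) := ⟨_, fun _ => rfl⟩
  obtain ⟨x', hx'⟩ : ∃ x' : BlockLM u c,
      x' = Xv (k + 1) _ _ (Fin.cons τ y) * Tg (k + 1) _ _ ^ (-ℓ) :=
    ⟨_, rfl⟩
  obtain ⟨t', ht'⟩ : ∃ t' : BlockLM u c, t' = Xv (k + 1) _ _ w * Tg (k + 1) _ _ ^ δ := ⟨_, rfl⟩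
  have hcons : ∀ x z : Fin k → ℤ,
      (Fin.cons 0 (x + z) : Fin (k + 1) → ℤ) = Fin.cons 0 x + Fin.cons 0 z := fun x z => by
    ext i; refine Fin.cases ?_ (fun i => ?_) i <;> simp
  have hιadd : ∀ x z, ι (x + z) = ι x * ι z := fun x z => by
    simp only [hι, hcons, Xv_add]
  have hιcomm : ∀ x, Commute x' (ι x) := fun x => by
    have hx : act c (-ℓ) x = x := by rw [act_apply, _root_.zpow_neg, h2]; simp
    rw [hx', hι, Commute, SemiconjBy, mul_assoc, Tg_zpow_mul_Xv_toQ, act_blockGL_cons_zero, hx,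
      ← mul_assoc, (Xv_commute _ _).eq, mul_assoc]
  have htι : ∀ x, t' * ι x = ι (act c δ x) * t' := fun x => by
    rw [ht', hι, hι, mul_assoc, Tg_zpow_mul_Xv_toQ, act_blockGL_cons_zero, ← mul_assoc,
      (Xv_commute _ _).eq, mul_assoc]
  have htx : t' * x' = (ι u * x') * t' := by
    have e1 : t' * x' = Xv (k + 1) _ _ (w + act (blockGL u c) δ (Fin.cons τ y)) *
        Tg (k + 1) _ _ ^ (δ - ℓ) := by
      rw [ht', hx', mul_assoc, ← mul_assoc (Tg (k + 1) _ _ ^ δ), Tg_zpow_mul_Xv_toQ, Xv_add,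
        sub_eq_add_neg, _root_.zpow_add]
      simp only [mul_assoc]
    have e2 : (ι u * x') * t' = Xv (k + 1) _ _ (Fin.cons 0 u + Fin.cons τ y +
        act (blockGL u c) (-ℓ) w) * Tg (k + 1) _ _ ^ (δ - ℓ) := by
      rw [ht', hx', hι, mul_assoc, mul_assoc, ← mul_assoc (Tg (k + 1) _ _ ^ (-ℓ)),
        Tg_zpow_mul_Xv_toQ, Xv_add, Xv_add, sub_eq_neg_add, _root_.zpow_add]
      simp only [mul_assoc]
    rw [e1, e2, hy]
  have hιz : ∀ (j : ℤ), ι (j • u) = ι u ^ j := fun j => by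
    have : (Fin.cons 0 (j • u) : Fin (k + 1) → ℤ) = j • Fin.cons 0 u := by
      ext i; refine Fin.cases ?_ (fun i => ?_) i <;> simp
    simp only [hι, this, Xv_zsmul]
  have htxz : ∀ j : ℤ, t' * x' ^ j = ι (j • u) * x' ^ j * t' := fun j => by
    have : SemiconjBy t' x' (ι u * x') := htx
    rw [(this.zpow_right j).eq, (hιcomm u).symm.mul_zpow, hιz]
  let F : BlockLM u (c ^ δ) →* BlockLM u c :=
    lift (MonoidHom.mk' (fun v => ι (Fin.tail v.toAdd) * x' ^ v.toAdd 0) fun v z => by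
      have e : Fin.tail ((v * z).toAdd) = Fin.tail v.toAdd + Fin.tail z.toAdd := rfl
      rw [e, hιadd, toAdd_mul, Pi.add_apply, _root_.zpow_add, mul_assoc, mul_assoc,
        ← mul_assoc (ι _) (x' ^ _), ← ((hιcomm _).zpow_left _).eq, mul_assoc]) t' fun v _ z hz => by
      rw [← act_one, act_toQ] at hz
      rw [ZtoQ_injective _ hz, act_blockGL_one]
      simp only [MonoidHom.mk'_apply, toAdd_ofAdd, Fin.tail_cons, Fin.cons_zero]
      rw [act_zpow, mul_one, ← mul_assoc, htι, mul_assoc, htxz, hιadd, ← mul_assoc, ← mul_assoc,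
        ← hιadd, ← hιadd, add_comm (act c δ _)]
  have hFT : F (Tg (k + 1) _ _) = t' := lift_Tg _ _ _
  have hFX : ∀ v, F (Xv (k + 1) _ _ v) = ι (Fin.tail v) * x' ^ v 0 := fun v => lift_Xv _ _ _ v
  have hι1 : ∀ x, firstHom u c (ι x) = 1 := fun x => by simp [hι]
  have hι2 : ∀ x, height (ι x) = 0 := fun x => by simp [hι]
  have hx1 : firstHom u c x' = .ofAdd τ := by simp [hx']
  have hx2 : height x' = -ℓ := by simp [hx']
  have ht1 : firstHom u c t' = .ofAdd (w 0) := by simp [ht']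
  have ht2 : height t' = δ := by simp [ht']
  have hinj : Function.Injective F := by
    rw [injective_iff_map_eq_one]
    intro g hg
    obtain ⟨v, hv⟩ := exists_eq_Xv_mul_Tg_zpow g
    obtain ⟨j, hj⟩ : ∃ j, j = height g := ⟨_, rfl⟩
    rw [← hj] at hv
    rw [hv, map_mul, map_zpow, hFX, hFT] at hg
    have e1 : -ℓ * v 0 + δ * j = 0 := by
      have := congrArg height hg
      simpa [hι2, hx2, ht2, mul_comm] using this
    have e2 : τ * v 0 + w 0 * j = 0 := by
      have := congrArg (fun g => (firstHom u c g).toAdd) hg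
      simpa [hι1, hx1, ht1, mul_comm] using this
    have e3 : v 0 = 0 := by
      linear_combination (-v 0) * h1 + δ * e2 - w 0 * e1
    have e4 : j = 0 := by
      linear_combination (-j) * h1 + τ * e1 + ℓ * e2
    rw [e3, e4, zpow_zero, zpow_zero, mul_one, mul_one, hι, ← e3, Fin.cons_self_tail] at hg
    have e5 : v = 0 := Xv_injective (hg.trans (Xv_zero).symm)
    rw [hv, e4, e5, Xv_zero, zpow_zero, mul_one]
  have hsurj : Function.Surjective F := by
    intro g
    obtain ⟨r, hr⟩ : ∃ r, r = (firstHom u c g).toAdd := ⟨_, rfl⟩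
    obtain ⟨j, hj⟩ : ∃ j, j = height g := ⟨_, rfl⟩
    obtain ⟨x, hx⟩ := exists_eq_Xv_cons_zero u c
      (g := g * (x' ^ (δ * r - w 0 * j) * t' ^ (τ * j + ℓ * r))⁻¹)
      (by
        simp only [height_mul, height_inv, height_zpow, hx2, ht2, ← hj]
        linear_combination (-j) * h1)
      (by
        apply Multiplicative.toAdd.injective
        simp only [map_mul, map_inv, map_zpow, toAdd_mul, toAdd_inv, toAdd_zpow, hx1, ht1, ← hr,
          toAdd_ofAdd, toAdd_one, smul_eq_mul]
        linear_combination (-r) * h1)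
    refine ⟨Xv (k + 1) _ _ (Fin.cons (δ * r - w 0 * j) x) * Tg (k + 1) _ _ ^ (τ * j + ℓ * r), ?_⟩
    rw [map_mul, map_zpow, hFX, hFT, Fin.tail_cons, Fin.cons_zero, hι, ← hx]
    simp [mul_assoc]
  refine ⟨MulEquiv.ofBijective F ⟨hinj, hsurj⟩, y, hFT.trans ht', fun v => ?_⟩
  rw [← hx']
  exact (hFX v).trans (by rw [hι])

end Block

end LM

lemma exists_GL_of_functional {k : ℕ} (φ : (Fin (k + 1) → ℤ) →+ ℤ) (hφ : ∃ v, φ v ≠ 0) :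
    ∃ (P : GL (Fin (k + 1)) ℤ) (ℓ : ℤ), ℓ ≠ 0 ∧ ∀ v, φ v = ℓ * act P 1 v 0 := by
  let f : (Fin (k + 1) → ℤ) →ₗ[ℤ] ℤ := φ.toIntLinearMap
  obtain ⟨ℓ, hℓ⟩ := (IsPrincipalIdealRing.principal (LinearMap.range f)).principal
  obtain ⟨e, he⟩ : ∃ e, f e = ℓ :=
    LinearMap.mem_range.1 (hℓ ▸ Submodule.mem_span_singleton_self ℓ)
  have hdvd : ∀ v, ∃ j : ℤ, j * ℓ = f v := fun v =>
    Submodule.mem_span_singleton.1 (hℓ ▸ LinearMap.mem_range_self f v)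
  have hℓ0 : ℓ ≠ 0 := by
    rintro rfl
    obtain ⟨v, hv⟩ := hφ
    obtain ⟨j, hj⟩ := hdvd v
    exact hv (hj.symm.trans (mul_zero j))
  obtain ⟨r, ⟨b₀⟩⟩ : ∃ r, Nonempty (Module.Basis (Fin r) ℤ (LinearMap.ker f)) :=
    ⟨_, ⟨Module.finBasis ℤ _⟩⟩
  let b := Module.Basis.mkFinCons e b₀
    (fun j x hx h => by
      have h1 := congrArg f h
      rw [map_add, map_smul, LinearMap.mem_ker.1 hx, add_zero, map_zero, he] at h1
      exact (mul_eq_zero.1 h1).resolve_right hℓ0)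
    (fun v => by
      obtain ⟨j, hj⟩ := hdvd v
      exact ⟨-j, LinearMap.mem_ker.2 (by rw [map_add, map_smul, he, ← hj]; simp)⟩)
  have hb : ⇑b = Fin.cons e (fun i => (b₀ i : Fin (k + 1) → ℤ)) := by
    simp only [b, Module.Basis.coe_mkFinCons]
    rfl
  obtain rfl : k = r := by
    have := Module.finrank_eq_card_basis b
    simpa using this
  obtain ⟨P, hP⟩ := exists_GL_of_linearEquiv b.equivFun
  refine ⟨P, ℓ, hℓ0, fun v => ?_⟩
  have hv := congrArg f (b.sum_equivFun v)
  rw [map_sum, Fin.sum_univ_succ, Finset.sum_eq_zero fun i _ => ?_] at hv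
  · rw [hP]
    change f v = _
    rw [← hv, hb, map_smul, Fin.cons_zero, he, add_zero, smul_eq_mul, mul_comm]
  · rw [hb, map_smul, Fin.cons_succ, LinearMap.mem_ker.1 (b₀ i).2, smul_zero]

namespace LM

/-- Integrally conjugate data give isomorphic groups. -/
lemma exists_equiv_of_GL {n : ℕ} {a a' : GL (Fin n) ℚ} {L L' : AddSubgroup (Fin n → ℤ)}
    (P : GL (Fin n) ℤ) (ha : toQ P * a = a' * toQ P) (hL : ∀ v, act P 1 v ∈ L' ↔ v ∈ L) :
    ∃ f : LM n (a : Matrix (Fin n) (Fin n) ℚ) L ≃* LM n (a' : Matrix (Fin n) (Fin n) ℚ) L',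
      (∀ v, f (Xv n _ L v) = Xv n _ L' (act P 1 v)) ∧ f (Tg n _ L) = Tg n _ L' := by
  let b : (Fin n → ℤ) ≃+ (Fin n → ℤ) :=
    { toFun := act P 1
      invFun := act P (-1)
      left_inv := fun v => by rw [act_act, neg_add_cancel, act_zero]
      right_inv := fun v => by rw [act_act, add_neg_cancel, act_zero]
      map_add' := map_add _ }
  refine nonempty_equiv_of_data b hL fun v w => ?_
  have h1 : ∀ v, ZtoQ n (b v) = act (toQ P) 1 (ZtoQ n v) := fun v => (act_toQ P 1 v).symm
  have h2 : (a' : Matrix (Fin n) (Fin n) ℚ) *ᵥ act (toQ P) 1 (ZtoQ n v) =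
      act (toQ P) 1 ((a : Matrix (Fin n) (Fin n) ℚ) *ᵥ ZtoQ n v) := by
    rw [act_one, act_one, Matrix.mulVec_mulVec, Matrix.mulVec_mulVec, ← Units.val_mul,
      ← Units.val_mul, ha]
  rw [h1, h1, h2, (act_injective (toQ P) 1).eq_iff]

lemma exists_equiv_of_height_eq {n m : ℕ} {M : GL (Fin n) ℤ} {M' : GL (Fin m) ℤ}
    (f : LM n (toQ M : Matrix (Fin n) (Fin n) ℚ) ⊤ ≃* LM m (toQ M' : Matrix (Fin m) (Fin m) ℚ) ⊤)
    (hX : ∀ v, height (f (Xv n _ _ v)) = 0) (hT : f (Tg n _ _) = Tg m _ _) :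
    ∃ b : (Fin n → ℤ) ≃+ (Fin m → ℤ), ∀ v, b (act M 1 v) = act M' 1 (b v) := by
  have hh : ∀ g, height (f g) = height g := fun g => by
    have := eq_height_of_Xv (χ := (heightHom _ _).comp f.toMonoidHom)
      (fun v => Multiplicative.toAdd.injective (hX v)) g
    refine this.trans ?_
    have h1 : Multiplicative.toAdd (((heightHom _ _).comp f.toMonoidHom) (Tg n _ _)) =
      height (f (Tg n _ _)) := rfl
    rw [h1, hT, height_Tg, one_mul]
  have hb : ∀ v, ∃ w, f (Xv n _ _ v) = Xv m _ _ w := fun v => by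
    obtain ⟨w, hw⟩ := exists_eq_Xv_mul_Tg_zpow (f (Xv n _ _ v))
    exact ⟨w, by rw [hw, hX, zpow_zero, mul_one]⟩
  choose b hb using hb
  have hbadd : ∀ v w, b (v + w) = b v + b w := fun v w => by
    apply Xv_injective (a := toQ M') (L := ⊤)
    rw [← hb, Xv_add, Xv_add, ← hb, ← hb, map_mul]
  have hbij : Function.Bijective (AddMonoidHom.mk' b hbadd) := by
    constructor
    · intro v w h
      have h : b v = b w := h
      exact Xv_injective (f.injective (by rw [hb, hb, h]))
    · intro w
      obtain ⟨v, hv⟩ := exists_eq_Xv_mul_Tg_zpow (f.symm (Xv m _ _ w))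
      rw [← hh, f.apply_symm_apply, height_Xv, zpow_zero, mul_one, f.symm_apply_eq, hb] at hv
      exact ⟨v, (Xv_injective hv).symm⟩
  refine ⟨AddEquiv.ofBijective _ hbij, fun v => ?_⟩
  have h := congrArg f (Tg_mul_Xv_toQ (M := M) v)
  rw [map_mul, map_mul, hT, hb, hb, Tg_mul_Xv_toQ] at h
  exact (Xv_injective (mul_right_cancel h)).symm

lemma exists_block_of_height_ne_zero {k m : ℕ} {M : GL (Fin (k + 1)) ℤ} {M' : GL (Fin m) ℤ}
    (f : LM (k + 1) (toQ M : Matrix (Fin (k + 1)) (Fin (k + 1)) ℚ) ⊤ ≃*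
      LM m (toQ M' : Matrix (Fin m) (Fin m) ℚ) ⊤)
    (hX : ∃ v, height (f (Xv (k + 1) _ _ v)) ≠ 0) :
    ∃ (u : Fin k → ℤ) (c : GL (Fin k) ℤ) (q : ℤ) (P : GL (Fin (k + 1)) ℤ)
      (b : (Fin (k + 1) → ℤ) ≃+ (Fin m → ℤ)), 0 < orderOf c ∧ Int.gcd q (orderOf c) = 1 ∧
      P * M = blockGL u c * P ∧
      ∀ v, b (act (blockGL u (c ^ q)) 1 v) = act M' 1 (b v) := by
  let φ : (Fin (k + 1) → ℤ) →+ ℤ := AddMonoidHom.mk' (fun v => height (f (Xv (k + 1) _ _ v)))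
    fun v w => by rw [Xv_add, map_mul, height_mul]
  obtain ⟨P, ℓ, hℓ0, hφ⟩ := exists_GL_of_functional φ hX
  have hφM : ∀ v, φ (act M 1 v) = φ v := fun v => by
    have := congrArg (fun g => height (f g)) (Tg_mul_Xv_toQ (M := M) v)
    simp only [map_mul, height_mul] at this
    have h : φ v + height (f (Tg (k + 1) _ _)) = φ (act M 1 v) + height (f (Tg (k + 1) _ _)) :=
      (add_comm _ _).trans this
    exact (add_right_cancel h).symm
  obtain ⟨u, c, huc⟩ := exists_eq_blockGL (P * M * P⁻¹) fun v => by
    have h1 : act (P * M * P⁻¹) 1 v = act P 1 (act M 1 (act P (-1) v)) := by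
      simp only [Units.val_mul, act_apply, _root_.zpow_neg, zpow_one, Matrix.mulVec_mulVec,
        Matrix.mul_assoc]
    have h2 := hφM (act P (-1) v)
    rw [hφ, hφ, act_act P, add_neg_cancel, act_zero, ← h1] at h2
    exact mul_left_cancel₀ hℓ0 h2
  have hPM : P * M = blockGL u c * P := by rw [← huc, inv_mul_cancel_right]
  obtain ⟨e, heX, heT⟩ := exists_equiv_of_GL (a := toQ M) (a' := toQ (blockGL u c)) (L := ⊤)
    (L' := ⊤) P (by rw [toQ, toQ, toQ, ← map_mul, ← map_mul, hPM]) (fun v => by simp)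
  obtain ⟨f', hf'⟩ : ∃ f' : BlockLM u c ≃* LM m (toQ M' : Matrix (Fin m) (Fin m) ℚ) ⊤,
    f' = e.symm.trans f := ⟨_, rfl⟩
  have hfX : ∀ v, height (f' (Xv (k + 1) _ _ v)) = ℓ * v 0 := fun v => by
    have h1 : e.symm (Xv (k + 1) _ _ v) = Xv (k + 1) _ _ (act P (-1) v) := by
      rw [e.symm_apply_eq, heX, act_act, add_neg_cancel, act_zero]
    rw [hf', MulEquiv.trans_apply, h1]
    exact (hφ _).trans (by rw [act_act, add_neg_cancel, act_zero])
  let χ : BlockLM u c →* Multiplicative ℤ := (heightHom _ _).comp f'.toMonoidHom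
  have hχ : ∀ g, (χ g).toAdd = height (f' g) := fun g => rfl
  have hχcomm : ∀ g h, χ g = 1 → χ h = 1 → Commute g h := fun g h hg hh => by
    have h1 := commute_of_height_eq_zero (QImage_toQ_le M' ⊤) (.inl rfl)
      (g := f' g) (h := f' h) (congrArg Multiplicative.toAdd hg)
      (congrArg Multiplicative.toAdd hh)
    exact f'.injective (by rw [map_mul, map_mul, h1.eq])
  have hc : c ^ ℓ = 1 := by
    rw [← inv_eq_one, ← _root_.zpow_neg]
    refine Units.ext (Matrix.ext_of_mulVec_single fun i => ?_)
    have h1 := act_eq_of_hom_int χ hχcomm (Pi.single 0 1) (k := Fin.cons 0 (Pi.single i 1))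
      (Multiplicative.toAdd.injective (by rw [hχ, hfX]; simp))
    rw [hχ, hfX, Pi.single_eq_same, mul_one, act_toQ, act_blockGL_cons_zero] at h1
    have h2 := congrArg Fin.tail (ZtoQ_injective _ h1)
    rw [Fin.tail_cons, Fin.tail_cons, act_apply] at h2
    rw [h2, Units.val_one, Matrix.one_mulVec]
  obtain ⟨t', ht'⟩ : ∃ t', f' t' = Tg m _ _ := f'.surjective _
  obtain ⟨w, hw⟩ := exists_eq_Xv_mul_Tg_zpow t'
  have h1 : ℓ * w 0 + height (f' (Tg (k + 1) _ _)) * height t' = 1 := by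
    have := congrArg height ht'
    rw [hw, map_mul, map_zpow, height_mul, height_zpow, hfX, height_Tg] at this
    linear_combination this
  obtain ⟨F, y, hFT, hFX⟩ := exists_equiv_block_zpow u c w _ _ ℓ h1 hc
  obtain ⟨b, hb⟩ := exists_equiv_of_height_eq (F.trans f')
    (fun v => by
      rw [MulEquiv.trans_apply, hFX, map_mul, height_mul, hfX, map_zpow, height_zpow, map_mul,
        height_mul, hfX, map_zpow, height_zpow, Fin.cons_zero, Fin.cons_zero]
      ring)
    (by rw [MulEquiv.trans_apply, hFT, ← hw, ht'])
  have hdvd : (orderOf c : ℤ) ∣ ℓ := orderOf_dvd_iff_zpow_eq_one.2 hc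
  refine ⟨u, c, height t', P, b, Nat.pos_of_ne_zero fun h => ?_, ?_, hPM, hb⟩
  · rw [h] at hdvd
    exact hℓ0 (zero_dvd_iff.1 (by simpa using hdvd))
  · obtain ⟨j, rfl⟩ := hdvd
    exact Int.isCoprime_iff_gcd_eq_one.1
      ⟨height (f' (Tg (k + 1) _ _)), j * w 0, by linear_combination h1⟩

lemma nonempty_equiv_blockLM_zpow {k : ℕ} (u : Fin k → ℤ) (c : GL (Fin k) ℤ) {q : ℤ}
    (hq : Int.gcd q (orderOf c) = 1) : Nonempty (BlockLM u (c ^ q) ≃* BlockLM u c) := by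
  obtain ⟨τ, j, h⟩ := Int.isCoprime_iff_gcd_eq_one.2 hq
  obtain ⟨F, -⟩ := exists_equiv_block_zpow u c (Pi.single 0 1) q τ (orderOf c * j)
    (by rw [Pi.single_eq_same]; linear_combination h)
    (by rw [_root_.zpow_mul, zpow_natCast, pow_orderOf_eq_one, _root_.one_zpow])
  exact ⟨F⟩

end LM

/-! ### The classification -/

section Matrices

variable {n : ℕ}

lemma exists_GL_eq {R : Type*} [CommRing R] {B : Matrix (Fin n) (Fin n) R} (hB : IsUnit B.det) :
    ∃ P : GL (Fin n) R, (P : Matrix (Fin n) (Fin n) R) = B :=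
  (Matrix.isUnit_iff_isUnit_det B).2 hB

lemma isUnit_det_GL {R : Type*} [CommRing R] (P : GL (Fin n) R) :
    IsUnit (P : Matrix (Fin n) (Fin n) R).det :=
  (Matrix.isUnit_iff_isUnit_det _).1 P.isUnit

lemma coe_eq_conj {R : Type*} [CommRing R] {P a a' : GL (Fin n) R} :
    (a' : Matrix (Fin n) (Fin n) R) = P * a * (P : Matrix (Fin n) (Fin n) R)⁻¹ ↔
      P * a = a' * P := by
  rw [← Matrix.coe_units_inv, ← Units.val_mul, ← Units.val_mul, Units.val_inj,
    eq_mul_inv_iff_mul_eq, eq_comm]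

lemma reindexSub_refl (L : AddSubgroup (Fin n → ℤ)) : reindexSub rfl L = L :=
  AddSubgroup.map_id L

lemma act_conj {R : Type*} [CommRing R] {P a a' : GL (Fin n) R} (h : P * a = a' * P) (j : ℤ)
    (v : Fin n → R) : act P 1 (act a j v) = act a' j (act P 1 v) := by
  rw [act_apply P, act_apply P, act_apply, act_apply, Matrix.mulVec_mulVec, Matrix.mulVec_mulVec,
    ← Units.val_mul, ← Units.val_mul, zpow_one, (SemiconjBy.zpow_right (a := P) h j).eq]

lemma mul_eq_mul_of_act {R : Type*} [CommRing R] {P a a' : GL (Fin n) R}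
    (h : ∀ v, act P 1 (act a 1 v) = act a' 1 (act P 1 v)) : P * a = a' * P := by
  refine Units.ext (Matrix.ext_of_mulVec_single fun i => ?_)
  rw [Units.val_mul, Units.val_mul, ← Matrix.mulVec_mulVec, ← Matrix.mulVec_mulVec]
  simpa only [act_one] using h (Pi.single i 1)

lemma mem_iUnion_conj {a P : GL (Fin n) ℚ} {x : Fin n → ℚ} :
    x ∈ ⋃ j : ℤ, ((a : Matrix (Fin n) (Fin n) ℚ) ^ j *
      (P : Matrix (Fin n) (Fin n) ℚ)⁻¹).mulVec '' Set.range (ZtoQ n) ↔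
      ∃ j v, act a j (act P (-1) (ZtoQ n v)) = x := by
  simp [act_apply, Matrix.coe_units_zpow, Matrix.mulVec_mulVec]

lemma iUnion_conj_inv {a P : GL (Fin n) ℚ} :
    (⋃ j : ℤ, (((a⁻¹ : GL (Fin n) ℚ) : Matrix (Fin n) (Fin n) ℚ) ^ j *
      (P : Matrix (Fin n) (Fin n) ℚ)⁻¹).mulVec '' Set.range (ZtoQ n)) =
      ⋃ j : ℤ, ((a : Matrix (Fin n) (Fin n) ℚ) ^ j *
        (P : Matrix (Fin n) (Fin n) ℚ)⁻¹).mulVec '' Set.range (ZtoQ n) := by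
  ext x
  rw [mem_iUnion_conj, mem_iUnion_conj]
  simp only [act_inv]
  exact (Equiv.neg ℤ).exists_congr fun j => Iff.rfl

lemma unionSet_eq_iff {P a a' : GL (Fin n) ℚ} (h : P * a = a' * P) :
    unionSet (a : Matrix (Fin n) (Fin n) ℚ) =
      ⋃ j : ℤ, ((a : Matrix (Fin n) (Fin n) ℚ) ^ j *
        (P : Matrix (Fin n) (Fin n) ℚ)⁻¹).mulVec '' Set.range (ZtoQ n) ↔
      ∀ x, act P 1 x ∈ unionSet (a' : Matrix (Fin n) (Fin n) ℚ) ↔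
        x ∈ unionSet (a : Matrix (Fin n) (Fin n) ℚ) := by
  rw [Set.ext_iff]
  refine forall_congr' fun x => ?_
  rw [mem_iUnion_conj, mem_unionSet (a := a')]
  refine iff_comm.trans (iff_congr (exists₂_congr fun j v => ?_) Iff.rfl)
  rw [← (act_injective P 1).eq_iff, act_conj h, act_act P, add_neg_cancel, act_zero]

/-- The linear automorphism given by an invertible matrix. -/
def actEquiv (P : GL (Fin n) ℚ) : (Fin n → ℚ) ≃ₗ[ℚ] (Fin n → ℚ) :=
  LinearEquiv.ofLinearMap (act P 1) (act P (-1)) (LinearMap.ext fun v => by simp [-act_one])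
    (LinearMap.ext fun v => by simp [-act_one])

lemma toQ_mul_eq_mul_of_lattice {P : GL (Fin n) ℤ} {a a' : GL (Fin n) ℚ}
    {B : (Fin n → ℚ) →ₗ[ℚ] (Fin n → ℚ)} (hB : ∀ v, B (ZtoQ n v) = ZtoQ n (act P 1 v))
    (h : ∀ v, B (act a 1 v) = act a' 1 (B v)) : toQ P * a = a' * toQ P := by
  have hBP : LinearMap.toMatrix' B = (toQ P : Matrix (Fin n) (Fin n) ℚ) :=
    matrix_ext_of_lattice fun v => by
      rw [LinearMap.toMatrix'_mulVec, hB, ← act_one, act_toQ]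
  have hBP' : ∀ v, B v = act (toQ P) 1 v := fun v => by
    rw [act_one, ← hBP, LinearMap.toMatrix'_mulVec]
  exact mul_eq_mul_of_act fun v => by rw [← hBP', ← hBP', h]

lemma toQ_mul_eq_mul {P M M' : GL (Fin n) ℤ} (h : P * M = M' * P) :
    toQ P * toQ M = toQ M' * toQ P := by
  rw [toQ, toQ, toQ, ← map_mul, ← map_mul, h]

end Matrices

namespace LM

section Trichotomy

variable {n m : ℕ} {a : GL (Fin n) ℚ} {a' : GL (Fin m) ℚ} {L : AddSubgroup (Fin n → ℤ)}
  {L' : AddSubgroup (Fin m → ℤ)}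

lemma ascending_of_equiv (hLA : QImage (a : Matrix (Fin n) (Fin n) ℚ) L ≤ (ZtoQ n).range)
    (hLA' : QImage (a' : Matrix (Fin m) (Fin m) ℚ) L' ≤ (ZtoQ m).range)
    (hasc : L = ⊤ ∨ ALsub (a : Matrix (Fin n) (Fin n) ℚ) L = ⊤)
    (f : LM n (a : Matrix (Fin n) (Fin n) ℚ) L ≃* LM m (a' : Matrix (Fin m) (Fin m) ℚ) L') :
    L' = ⊤ ∨ ALsub (a' : Matrix (Fin m) (Fin m) ℚ) L' = ⊤ := by
  by_contra! h
  obtain ⟨x₁, x₂, y₁, y₂, hc⟩ := exists_commutators_not_commute hLA' h.1 h.2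
  refine hc (f.symm.injective ?_)
  have := commute_of_height_eq_zero hLA hasc
    (g := f.symm (x₁ * x₂ * x₁⁻¹ * x₂⁻¹)) (h := f.symm (y₁ * y₂ * y₁⁻¹ * y₂⁻¹))
    (by simp only [map_mul, map_inv, height_mul, height_inv]; ring)
    (by simp only [map_mul, map_inv, height_mul, height_inv]; ring)
  rw [map_mul f.symm (x₁ * x₂ * x₁⁻¹ * x₂⁻¹), this.eq, ← map_mul]

lemma exists_equiv_neg_height (a : GL (Fin n) ℚ) (L : AddSubgroup (Fin n → ℤ)) :
    ∃ e : LM n ((a⁻¹ : GL (Fin n) ℚ) : Matrix (Fin n) (Fin n) ℚ)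
        (ALsub (a : Matrix (Fin n) (Fin n) ℚ) L) ≃* LM n (a : Matrix (Fin n) (Fin n) ℚ) L,
      (∀ v, e (Xv n _ _ v) = Xv n _ _ v) ∧ ∀ g, height (e g) = -height g := by
  obtain ⟨e, heX, heT⟩ := nonempty_equiv_inv a L
  have hsX : ∀ v, e.symm (Xv n _ _ v) = Xv n _ _ v := fun v => by rw [e.symm_apply_eq, heX]
  have hsT : e.symm (Tg n _ _) = (Tg n _ _)⁻¹ := by
    rw [e.symm_apply_eq, map_inv, heT, inv_inv]
  refine ⟨e.symm, hsX, fun g => ?_⟩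
  induction g using induction_mul with
  | hX v => simp [hsX]
  | hT => simp [hsT]
  | hT' => simp [hsT]
  | hmul g h hg hh => rw [map_mul, height_mul, height_mul, hg, hh, neg_add]

lemma exists_base_data (hL : L.FiniteIndex) (hL' : L'.FiniteIndex)
    (hLA : QImage (a : Matrix (Fin n) (Fin n) ℚ) L ≤ (ZtoQ n).range)
    (hLA' : QImage (a' : Matrix (Fin m) (Fin m) ℚ) L' ≤ (ZtoQ m).range)
    (hasc : ¬ (L = ⊤ ∨ ALsub (a : Matrix (Fin n) (Fin n) ℚ) L = ⊤))
    (hasc' : ¬ (L' = ⊤ ∨ ALsub (a' : Matrix (Fin m) (Fin m) ℚ) L' = ⊤))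
    (f : LM n (a : Matrix (Fin n) (Fin n) ℚ) L ≃* LM m (a' : Matrix (Fin m) (Fin m) ℚ) L') :
    ∃ (b : (Fin n → ℤ) ≃+ (Fin m → ℤ)) (B : (Fin n → ℚ) →ₗ[ℚ] (Fin m → ℚ)),
      (∀ v, B (ZtoQ n v) = ZtoQ m (b v)) ∧
      ((L' = L.map b.toAddMonoidHom ∧ ∀ v, B (act a 1 v) = act a' 1 (B v)) ∨
        (L' = (ALsub (a : Matrix (Fin n) (Fin n) ℚ) L).map b.toAddMonoidHom ∧
          ∀ v, B (act a⁻¹ 1 v) = act a' 1 (B v))) := by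
  rw [not_or] at hasc hasc'
  obtain ⟨g, b, hb⟩ := exists_equiv_preserving_base hL hL' hLA hLA' hasc.1 hasc.2 hasc'.1 hasc'.2 f
  rcases height_eq_or_neg g (fun v => by rw [hb, height_Xv]) with hg | hg
  · obtain ⟨h1, B, h2, h3⟩ := data_of_preserving_base hL hLA hLA' g b hb hg
    exact ⟨b, B, h3, .inl ⟨h1, h2⟩⟩
  · obtain ⟨e, heX, he⟩ := exists_equiv_neg_height a L
    obtain ⟨h1, B, h2, h3⟩ := data_of_preserving_base (finiteIndex_ALsub hL) QImage_inv_le hLA'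
      (e.trans g) b (fun v => by rw [MulEquiv.trans_apply, heX, hb])
      (fun x => by rw [MulEquiv.trans_apply, hg, he, neg_neg])
    exact ⟨b, B, h3, .inr ⟨h1, h2⟩⟩

/-- An isomorphism of ascending groups which preserves heights comes from a linear equivalence
preserving the union of the translates of the lattice. -/
lemma exists_union_data_of_height_eq (hL : L.FiniteIndex) (hL' : L'.FiniteIndex)
    (hLA : QImage (a : Matrix (Fin n) (Fin n) ℚ) L ≤ (ZtoQ n).range)
    (hLA' : QImage (a' : Matrix (Fin m) (Fin m) ℚ) L' ≤ (ZtoQ m).range)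
    (hasc : L = ⊤ ∨ ALsub (a : Matrix (Fin n) (Fin n) ℚ) L = ⊤)
    (hasc' : L' = ⊤ ∨ ALsub (a' : Matrix (Fin m) (Fin m) ℚ) L' = ⊤)
    (f : LM n (a : Matrix (Fin n) (Fin n) ℚ) L ≃* LM m (a' : Matrix (Fin m) (Fin m) ℚ) L')
    (hf : ∀ g, height (f g) = height g) :
    ∃ B : (Fin n → ℚ) ≃ₗ[ℚ] (Fin m → ℚ), (∀ v, B (act a 1 v) = act a' 1 (B v)) ∧
      ∀ x, B x ∈ unionSet (a' : Matrix (Fin m) (Fin m) ℚ) ↔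
        x ∈ unionSet (a : Matrix (Fin n) (Fin n) ℚ) := by
  obtain ⟨B, hB, hBf⟩ := exists_linearEquiv_of_height hL hL' hLA hLA' f hf
  refine ⟨B, hB, fun x => ⟨fun hx => ?_, fun hx => ?_⟩⟩
  · obtain ⟨g, hg, hgx⟩ := exists_height_zero (L := L') hx
    have h0 : height (f.symm g) = 0 := by rw [← hf, f.apply_symm_apply, hg]
    have h1 := hBf _ h0
    rw [f.apply_symm_apply, hgx] at h1
    rw [B.injective h1]
    exact vec_mem_unionSet hLA hasc _
  · obtain ⟨g, hg, rfl⟩ := exists_height_zero (L := L) hx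
    rw [← hBf g hg]
    exact vec_mem_unionSet hLA' hasc' _

lemma exists_union_data (hL : L.FiniteIndex) (hL' : L'.FiniteIndex)
    (hLA : QImage (a : Matrix (Fin n) (Fin n) ℚ) L ≤ (ZtoQ n).range)
    (hLA' : QImage (a' : Matrix (Fin m) (Fin m) ℚ) L' ≤ (ZtoQ m).range)
    (hasc : L = ⊤ ∨ ALsub (a : Matrix (Fin n) (Fin n) ℚ) L = ⊤)
    (hasc' : L' = ⊤ ∨ ALsub (a' : Matrix (Fin m) (Fin m) ℚ) L' = ⊤)
    (f : LM n (a : Matrix (Fin n) (Fin n) ℚ) L ≃* LM m (a' : Matrix (Fin m) (Fin m) ℚ) L')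
    (hf : ∀ v, height (f (Xv n _ L v)) = 0) :
    ∃ B : (Fin n → ℚ) ≃ₗ[ℚ] (Fin m → ℚ),
      ((∀ v, B (act a 1 v) = act a' 1 (B v)) ∨ ∀ v, B (act a⁻¹ 1 v) = act a' 1 (B v)) ∧
      ∀ x, B x ∈ unionSet (a' : Matrix (Fin m) (Fin m) ℚ) ↔
        x ∈ unionSet (a : Matrix (Fin n) (Fin n) ℚ) := by
  rcases height_eq_or_neg f hf with hg | hg
  · obtain ⟨B, hB, hU⟩ := exists_union_data_of_height_eq hL hL' hLA hLA' hasc hasc' f hg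
    exact ⟨B, .inl hB, hU⟩
  · obtain ⟨e, -, he⟩ := exists_equiv_neg_height a L
    obtain ⟨B, hB, hU⟩ := exists_union_data_of_height_eq (finiteIndex_ALsub hL) hL' QImage_inv_le
      hLA' (by rwa [ALsub_inv hLA, or_comm]) hasc' (e.trans f)
      fun x => by rw [MulEquiv.trans_apply, hg, he, neg_neg]
    exact ⟨B, .inr hB, fun x => by rw [hU, unionSet_inv]⟩

lemma eq_top_of_height_ne_zero (hLA : QImage (a : Matrix (Fin n) (Fin n) ℚ) L ≤ (ZtoQ n).range)
    (hLA' : QImage (a' : Matrix (Fin m) (Fin m) ℚ) L' ≤ (ZtoQ m).range)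
    (hasc : L = ⊤ ∨ ALsub (a : Matrix (Fin n) (Fin n) ℚ) L = ⊤)
    (hasc' : L' = ⊤ ∨ ALsub (a' : Matrix (Fin m) (Fin m) ℚ) L' = ⊤)
    (f : LM n (a : Matrix (Fin n) (Fin n) ℚ) L ≃* LM m (a' : Matrix (Fin m) (Fin m) ℚ) L')
    (hX : ∃ v, height (f (Xv n _ L v)) ≠ 0) :
    L = ⊤ ∧ ALsub (a : Matrix (Fin n) (Fin n) ℚ) L = ⊤ := by
  refine eq_top_of_hom_int hLA hasc ((heightHom _ _).comp f.toMonoidHom) (fun g h hg hh => ?_) ?_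
  · have h1 := commute_of_height_eq_zero hLA' hasc' (g := f g) (h := f h)
      (congrArg Multiplicative.toAdd hg) (congrArg Multiplicative.toAdd hh)
    exact f.injective (by rw [map_mul, map_mul, h1.eq])
  · obtain ⟨v, hv⟩ := hX
    exact ⟨v, fun h => hv (congrArg Multiplicative.toAdd h)⟩

lemma exists_height_symm_ne_zero
    (f : LM n (a : Matrix (Fin n) (Fin n) ℚ) L ≃* LM m (a' : Matrix (Fin m) (Fin m) ℚ) L')
    (hX : ∃ v, height (f (Xv n _ L v)) ≠ 0) : ∃ v, height (f.symm (Xv m _ L' v)) ≠ 0 := by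
  by_contra! h
  obtain ⟨v, hv⟩ := hX
  rcases height_eq_or_neg f.symm h with h | h <;>
  · have h1 := h (f (Xv n _ L v))
    rw [f.symm_apply_apply, height_Xv] at h1
    omega

end Trichotomy

section Backward

variable {n : ℕ} {a a' : GL (Fin n) ℚ} {L L' : AddSubgroup (Fin n → ℤ)}

lemma nonempty_equiv_of_union_data (hLA : QImage (a : Matrix (Fin n) (Fin n) ℚ) L ≤ (ZtoQ n).range)
    (hLA' : QImage (a' : Matrix (Fin n) (Fin n) ℚ) L' ≤ (ZtoQ n).range)
    (hasc : L = ⊤ ∨ ALsub (a : Matrix (Fin n) (Fin n) ℚ) L = ⊤)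
    (hasc' : L' = ⊤ ∨ ALsub (a' : Matrix (Fin n) (Fin n) ℚ) L' = ⊤)
    {P : GL (Fin n) ℚ} (hP : P * a = a' * P)
    (hU : unionSet (a : Matrix (Fin n) (Fin n) ℚ) =
      ⋃ j : ℤ, ((a : Matrix (Fin n) (Fin n) ℚ) ^ j *
        (P : Matrix (Fin n) (Fin n) ℚ)⁻¹).mulVec '' Set.range (ZtoQ n)) :
    Nonempty (LM n (a : Matrix (Fin n) (Fin n) ℚ) L ≃*
      LM n (a' : Matrix (Fin n) (Fin n) ℚ) L') :=
  nonempty_equiv_of_conj hLA hasc hLA' hasc' (actEquiv P) (act_conj hP) ((unionSet_eq_iff hP).1 hU)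

lemma exists_equiv_of_map_eq {P : GL (Fin n) ℤ} (hP : toQ P * a = a' * toQ P)
    (hL : L' = L.map (P : Matrix (Fin n) (Fin n) ℤ).mulVecLin.toAddMonoidHom) :
    Nonempty (LM n (a : Matrix (Fin n) (Fin n) ℚ) L ≃*
      LM n (a' : Matrix (Fin n) (Fin n) ℚ) L') := by
  obtain ⟨f, -⟩ := exists_equiv_of_GL (L := L) (L' := L') P hP fun v => by
    rw [hL, AddSubgroup.mem_map]
    constructor
    · rintro ⟨w, hw, h⟩
      rwa [← act_injective P 1 ((act_one P w).trans h)]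
    · exact fun hv => ⟨v, hv, (act_one P v).symm⟩
  exact ⟨f⟩

end Backward

end LM

/-- **Theorem (classification of Leary–Minasyan groups).**
`G(A,L) ≅ G(Ā,L̄)` iff `n = n̄` and one of conditions (i)–(iii) holds. -/
theorem LM_isomorphism_classification
    (n nb : ℕ) (A : Matrix (Fin n) (Fin n) ℚ) (Ab : Matrix (Fin nb) (Fin nb) ℚ)
    (hA : IsUnit A.det) (hAb : IsUnit Ab.det)
    (L : AddSubgroup (Fin n → ℤ)) (Lb : AddSubgroup (Fin nb → ℤ))
    (hL : L.FiniteIndex) (hLb : Lb.FiniteIndex)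
    (hLA : QImage A L ≤ (ZtoQ n).range) (hLAb : QImage Ab Lb ≤ (ZtoQ nb).range) :
    Nonempty (LM n A L ≃* LM nb Ab Lb) ↔
      ∃ h : nb = n,
        -- (i)
        (∃ B : Matrix (Fin n) (Fin n) ℤ, IsUnit B.det ∧
            ((Matrix.reindex (finCongr h) (finCongr h) Ab = QMat B * A * (QMat B)⁻¹ ∧
                reindexSub h Lb = L.map B.mulVecLin.toAddMonoidHom) ∨
             (Matrix.reindex (finCongr h) (finCongr h) Ab = QMat B * A⁻¹ * (QMat B)⁻¹ ∧
                reindexSub h Lb = (ALsub A L).map B.mulVecLin.toAddMonoidHom))) ∨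
        -- (ii)
        ((L = ⊤ ∨ ALsub A L = ⊤) ∧ (Lb = ⊤ ∨ ALsub Ab Lb = ⊤) ∧
          ∃ B : Matrix (Fin n) (Fin n) ℚ, IsUnit B.det ∧
            (Matrix.reindex (finCongr h) (finCongr h) Ab = B * A * B⁻¹ ∨
             Matrix.reindex (finCongr h) (finCongr h) Ab = B * A⁻¹ * B⁻¹) ∧
            unionSet A = ⋃ j : ℤ, (A ^ j * B⁻¹).mulVec '' Set.range (ZtoQ n)) ∨
        -- (iii)
        (L = ⊤ ∧ ALsub A L = ⊤ ∧ Lb = ⊤ ∧ ALsub Ab Lb = ⊤ ∧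
          ∃ k : ℕ, ∃ hk : k + 1 = n, ∃ C : Matrix (Fin k) (Fin k) ℤ, ∃ m : ℕ,
            0 < m ∧ orderOf C = m ∧
            ∃ u : Fin k → ℤ, ∃ q : ℤ, Int.gcd q m = 1 ∧
              (∃ B : Matrix (Fin n) (Fin n) ℤ, IsUnit B.det ∧
                A = QMat B *
                    Matrix.reindex (finCongr hk) (finCongr hk) (QMat (blockOne u C)) *
                    (QMat B)⁻¹) ∧
              (∃ B : Matrix (Fin n) (Fin n) ℤ, IsUnit B.det ∧
                Matrix.reindex (finCongr h) (finCongr h) Ab = QMat B *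
                    Matrix.reindex (finCongr hk) (finCongr hk) (QMat (blockOne u (C ^ q))) *
                    (QMat B)⁻¹)) := by
  obtain ⟨a, rfl⟩ := exists_GL_eq hA
  obtain ⟨a', rfl⟩ := exists_GL_eq hAb
  constructor
  · rintro ⟨f⟩
    by_cases hasc : L = ⊤ ∨ ALsub (a : Matrix (Fin n) (Fin n) ℚ) L = ⊤
    · have hasc' := LM.ascending_of_equiv hLA hLAb hasc f
      by_cases hX : ∃ v, LM.height (f (Xv n _ L v)) ≠ 0
      · obtain ⟨rfl, hAL⟩ := LM.eq_top_of_height_ne_zero hLA hLAb hasc hasc' f hX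
        obtain ⟨rfl, hAL'⟩ := LM.eq_top_of_height_ne_zero hLAb hLA hasc' hasc f.symm
          (LM.exists_height_symm_ne_zero f hX)
        obtain ⟨M, rfl⟩ := exists_toQ_eq hLA hAL
        obtain ⟨M', rfl⟩ := exists_toQ_eq hLAb hAL'
        obtain _ | k := n
        · obtain ⟨v, hv⟩ := hX
          rw [Subsingleton.elim v 0, LM.Xv_zero, map_one, LM.height_one] at hv
          exact absurd rfl hv
        obtain ⟨u, c, q, P, b, hc, hq, hP, hb⟩ := LM.exists_block_of_height_ne_zero f hX
        obtain rfl : nb = k + 1 := by simpa using b.toIntLinearEquiv.finrank_eq.symm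
        obtain ⟨P', hP'⟩ := exists_GL_of_linearEquiv b.toIntLinearEquiv
        refine ⟨rfl, .inr (.inr ⟨rfl, hAL, rfl, hAL', k, rfl, c, orderOf c, hc, orderOf_units, u, q,
          hq, ⟨(P⁻¹ : GL (Fin (k + 1)) ℤ), isUnit_det_GL _, ?_⟩, ⟨P', isUnit_det_GL _, ?_⟩⟩)⟩
        · exact coe_eq_conj.2 (toQ_mul_eq_mul (M := blockGL u c)
            (by rw [inv_mul_eq_iff_eq_mul, ← mul_assoc, hP, mul_inv_cancel_right]))
        · rw [← Matrix.coe_units_zpow]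
          exact coe_eq_conj.2 (toQ_mul_eq_mul (M := blockGL u (c ^ q))
            (mul_eq_mul_of_act fun v => by rw [hP', hP']; exact hb v))
      · push Not at hX
        obtain ⟨B, hB, hU⟩ := LM.exists_union_data hL hLb hLA hLAb hasc hasc' f hX
        obtain rfl : nb = n := by simpa using B.finrank_eq.symm
        obtain ⟨P, hP⟩ := exists_GL_of_linearEquiv B
        simp only [← hP] at hB hU
        refine ⟨rfl, .inr (.inl ⟨hasc, hasc', P, isUnit_det_GL _, ?_⟩)⟩
        rcases hB with hB | hB
        · have h := mul_eq_mul_of_act hB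
          exact ⟨.inl (coe_eq_conj.2 h), (unionSet_eq_iff h).2 hU⟩
        · have h := mul_eq_mul_of_act hB
          rw [← Matrix.coe_units_inv a, ← iUnion_conj_inv, ← unionSet_inv]
          exact ⟨.inr (coe_eq_conj.2 h), (unionSet_eq_iff h).2 (by rwa [unionSet_inv])⟩
    · have hasc' := fun h => hasc (LM.ascending_of_equiv hLAb hLA h f.symm)
      obtain ⟨b, B, hbB, h⟩ := LM.exists_base_data hL hLb hLA hLAb hasc hasc' f
      obtain rfl : nb = n := by simpa using b.toIntLinearEquiv.finrank_eq.symm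
      obtain ⟨P, hP⟩ := exists_GL_of_linearEquiv b.toIntLinearEquiv
      have hPb : b.toAddMonoidHom = (P : Matrix (Fin nb) (Fin nb) ℤ).mulVecLin.toAddMonoidHom :=
        AddMonoidHom.ext fun v => (hP v).symm.trans (act_one P v)
      have hbB' : ∀ v, B (ZtoQ nb v) = ZtoQ nb (act P 1 v) := fun v => by rw [hP]; exact hbB v
      refine ⟨rfl, .inl ⟨P, isUnit_det_GL _, ?_⟩⟩
      rw [reindexSub_refl, ← hPb, ← Matrix.coe_units_inv a]
      exact h.imp
        (fun h => ⟨coe_eq_conj.2 (toQ_mul_eq_mul_of_lattice hbB' h.2), h.1⟩)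
        (fun h => ⟨coe_eq_conj.2 (toQ_mul_eq_mul_of_lattice hbB' h.2), h.1⟩)
  · rintro ⟨rfl, h⟩
    obtain ⟨e, -⟩ := LM.exists_equiv_neg_height a L
    rw [reindexSub_refl, ← Matrix.coe_units_inv a] at h
    rcases h with ⟨B, hB, h⟩ | ⟨hasc, hasc', B, hB, h, hU⟩ |
      ⟨rfl, -, rfl, -, k, rfl, C, m, hm, rfl, u, q, hq, ⟨B, hB, h⟩, B', hB', h'⟩
    · obtain ⟨P, rfl⟩ := exists_GL_eq hB
      rcases h with ⟨h, h'⟩ | ⟨h, h'⟩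
      · exact LM.exists_equiv_of_map_eq (coe_eq_conj.1 h) h'
      · obtain ⟨f⟩ := LM.exists_equiv_of_map_eq (coe_eq_conj.1 h) h'
        exact ⟨e.symm.trans f⟩
    · obtain ⟨P, rfl⟩ := exists_GL_eq hB
      rcases h with h | h
      · exact LM.nonempty_equiv_of_union_data hLA hLAb hasc hasc' (coe_eq_conj.1 h) hU
      · rw [← iUnion_conj_inv, ← unionSet_inv] at hU
        obtain ⟨f⟩ := LM.nonempty_equiv_of_union_data QImage_inv_le hLAb
          (by rwa [ALsub_inv hLA, or_comm]) hasc' (coe_eq_conj.1 h) hU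
        exact ⟨e.symm.trans f⟩
    · obtain ⟨P, rfl⟩ := exists_GL_eq hB
      obtain ⟨P', rfl⟩ := exists_GL_eq hB'
      obtain ⟨c, rfl⟩ := (orderOf_pos_iff.1 hm).isUnit
      rw [← Matrix.coe_units_zpow] at h'
      rw [orderOf_units] at hq
      obtain ⟨f₁, -⟩ := LM.exists_equiv_of_GL (a := toQ (blockGL u c)) (L := ⊤) (L' := ⊤) P
        (coe_eq_conj.1 h) (by simp)
      obtain ⟨f₂, -⟩ := LM.exists_equiv_of_GL (a := toQ (blockGL u (c ^ q))) (L := ⊤) (L' := ⊤) P'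
        (coe_eq_conj.1 h') (by simp)
      obtain ⟨f⟩ := LM.nonempty_equiv_blockLM_zpow u c hq
      exact ⟨f₁.symm.trans (f.symm.trans f₂)⟩
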